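/- Let m ≥ 2, n ≥ 1, k ≥ 2, and consider the Fadell–Neuwirth fibration p : F(ℝ^k, m+n) → F(ℝ^k, m), (z₁,…,z_m,z_{m+1},…,z_{m+n}) ↦ (z₁,…,z_m), with F(ℝ^k, m) carrying the d-structure of paths non-decreasing in each of the km real coordinates and F(ℝ^k, m+n) carrying the associated d-structure (γ directed iff p∘γ is directed). Then the directed parametrized topological complexity is vTC[p] = 2n + m if k is odd, and vTC[p] = 2n + m − 1 if k is even. -/

import Mathlib

open unitInterval Set Topology

noncomputable section

/-- Concatenation of two continuous maps from the unit interval, when the endpoint of the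
first is the starting point of the second. -/
def concatCM {X : Type*} [TopologicalSpace X] (γ δ : C(I, X)) (h : γ 1 = δ 0) : C(I, X) :=
  ((⟨γ, rfl, rfl⟩ : Path (γ 0) (γ 1)).trans
    ((⟨δ, rfl, rfl⟩ : Path (δ 0) (δ 1)).cast h rfl)).toContinuousMap

lemma concatCM_apply {X : Type*} [TopologicalSpace X] (γ δ : C(I, X)) (h : γ 1 = δ 0) (t : I) :
    concatCM γ δ h t =
      if ht : (t : ℝ) ≤ 1 / 2 then γ ⟨2 * t, (unitInterval.mul_pos_mem_iff two_pos).2 ⟨t.2.1, ht⟩⟩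
      else δ ⟨2 * t - 1, unitInterval.two_mul_sub_one_mem_iff.2 ⟨(not_le.1 ht).le, t.2.2⟩⟩ := by
  have := Path.trans_apply (⟨γ, rfl, rfl⟩ : Path (γ 0) (γ 1))
    ((⟨δ, rfl, rfl⟩ : Path (δ 0) (δ 1)).cast h rfl) t
  simpa [concatCM, Path.cast] using this

@[simp] lemma concatCM_zero {X : Type*} [TopologicalSpace X] (γ δ : C(I, X)) (h : γ 1 = δ 0) :
    concatCM γ δ h 0 = γ 0 := by
  simp [concatCM_apply]

@[simp] lemma concatCM_one {X : Type*} [TopologicalSpace X] (γ δ : C(I, X)) (h : γ 1 = δ 0) :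
    concatCM γ δ h 1 = δ 1 := by
  rw [concatCM_apply]
  norm_num

lemma comp_concatCM {X Y : Type*} [TopologicalSpace X] [TopologicalSpace Y]
    (f : C(X, Y)) (γ δ : C(I, X)) (h : γ 1 = δ 0) :
    f.comp (concatCM γ δ h) =
      concatCM (f.comp γ) (f.comp δ) (by simpa using congrArg f h) := by
  ext t
  simp only [ContinuousMap.comp_apply, concatCM_apply]
  split_ifs <;> rfl

lemma monotone_concatCM {Z : Type*} [TopologicalSpace Z] [Preorder Z] {γ δ : C(I, Z)}
    (h : γ 1 = δ 0) (hγ : Monotone γ) (hδ : Monotone δ) : Monotone ⇑(concatCM γ δ h) := by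
  intro s t hst
  have hst' : (s : ℝ) ≤ (t : ℝ) := hst
  rw [concatCM_apply, concatCM_apply]
  split_ifs with hs ht ht
  · exact hγ (Subtype.mk_le_mk.2 (by linarith))
  · calc γ _ ≤ γ 1 := hγ (unitInterval.le_one _)
      _ = δ 0 := h
      _ ≤ δ _ := hδ (unitInterval.nonneg _)
  · exact absurd (hst'.trans ht) hs
  · exact hδ (Subtype.mk_le_mk.2 (by linarith))

/-- A d-space structure on a topological space: a distinguished set of paths containing the
constant paths, closed under concatenation, and closed under pre-composition with
continuous non-decreasing reparametrizations of the interval. -/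
structure DStruct (X : Type*) [TopologicalSpace X] where
  paths : Set C(I, X)
  const_mem : ∀ x : X, ContinuousMap.const I x ∈ paths
  concat_mem : ∀ γ ∈ paths, ∀ δ ∈ paths, ∀ h : γ 1 = δ 0, concatCM γ δ h ∈ paths
  reparam_mem : ∀ γ ∈ paths, ∀ φ : C(I, I), Monotone φ → γ.comp φ ∈ paths

variable {X : Type*} [TopologicalSpace X] {Y : Type*} [TopologicalSpace Y]

/-- The set `Γ_X` of pairs of points joined by a directed path. -/
def dGamma (dX : DStruct X) : Set (X × X) :=
  {q | ∃ γ ∈ dX.paths, γ 0 = q.1 ∧ γ 1 = q.2}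

/-- The set `dX(x, x')` of directed paths from `x` to `x'`. -/
def dBetween (dX : DStruct X) (x x' : X) : Set C(I, X) :=
  {γ | γ ∈ dX.paths ∧ γ 0 = x ∧ γ 1 = x'}

/-- An initial point of a d-space: a point from which there is a directed path to any point. -/
def IsInitialPoint (dX : DStruct X) (x₀ : X) : Prop := ∀ x : X, (x₀, x) ∈ dGamma dX

/-- A d-space is strongly connected if any ordered pair of points is joined by a d-path. -/
def StronglyConnected (dX : DStruct X) : Prop := dGamma dX = Set.univ

/-- A space is a Euclidean Neighbourhood Retract if it embeds in some Euclidean space as a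
retract of an open neighbourhood of itself. -/
def IsENR (A : Type*) [TopologicalSpace A] : Prop :=
  ∃ (N : ℕ) (e : A → (Fin N → ℝ)), IsEmbedding e ∧
    ∃ U : Set (Fin N → ℝ), IsOpen U ∧ Set.range e ⊆ U ∧
      ∃ r : U → A, Continuous r ∧ ∀ (a : A) (h : e a ∈ U), r ⟨e a, h⟩ = a

/-- A subset of a space is an ENR if the corresponding subspace is an ENR. -/
def IsENRSet {Z : Type*} [TopologicalSpace Z] (A : Set Z) : Prop := IsENR A

/-- A subset of `X × X` admits a continuous section of the directed endpoint map
`π⃗ : dX → Γ_X`. -/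
def DSecSet (dX : DStruct X) (U : Set (X × X)) : Prop :=
  ∃ s : U → C(I, X), Continuous s ∧
    ∀ u : U, s u ∈ dX.paths ∧ (s u) 0 = u.1.1 ∧ (s u) 1 = u.1.2

/-- The directed topological complexity of a d-space: the smallest number of ENRs covering
`Γ_X`, each admitting a continuous section of the directed endpoint map. -/
def vTC (dX : DStruct X) : ℕ∞ :=
  sInf {n : ℕ∞ | ∃ m : ℕ, n = (m : ℕ∞) ∧ ∃ U : Fin m → Set (X × X),
    (∀ i, IsENRSet (U i) ∧ DSecSet dX (U i)) ∧ dGamma dX ⊆ ⋃ i, U i}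

/-- A subset of `X` admits a continuous section of the evaluation map
`e_X : d₀X → X`, `γ ↦ γ(1)`, where `d₀X` is the space of d-paths starting at `x₀`. -/
def CatSecSet (dX : DStruct X) (x₀ : X) (U : Set X) : Prop :=
  ∃ s : U → C(I, X), Continuous s ∧
    ∀ u : U, s u ∈ dX.paths ∧ (s u) 0 = x₀ ∧ (s u) 1 = (u : X)

/-- The directed Lusternik–Schnirelmann category of a d-space with initial point `x₀`:
the smallest number of ENRs covering `X`, each admitting a continuous section of the
evaluation map `e_X : d₀X → X`. -/
def vcat (dX : DStruct X) (x₀ : X) : ℕ∞ :=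
  sInf {n : ℕ∞ | ∃ m : ℕ, n = (m : ℕ∞) ∧ ∃ U : Fin m → Set X,
    (∀ i, IsENRSet (U i) ∧ CatSecSet dX x₀ (U i)) ∧ ∀ x : X, ∃ i, x ∈ U i}

/-- A subset of `X × X` admits a continuous section of the free path space fibration. -/
def SecSet (X : Type*) [TopologicalSpace X] (U : Set (X × X)) : Prop :=
  ∃ s : U → C(I, X), Continuous s ∧ ∀ u : U, (s u) 0 = u.1.1 ∧ (s u) 1 = u.1.2

/-- The (Farber) topological complexity of a space, unnormalized convention. -/
def farberTC (X : Type*) [TopologicalSpace X] : ℕ∞ :=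
  sInf {n : ℕ∞ | ∃ m : ℕ, n = (m : ℕ∞) ∧ ∃ U : Fin m → Set (X × X),
    (∀ i, IsOpen (U i) ∧ SecSet X (U i)) ∧ ∀ q : X × X, ∃ i, q ∈ U i}

/-- The inclusion of a subset `U ⊆ X` is nullhomotopic. -/
def NullhomotopicIncl {Z : Type*} [TopologicalSpace Z] (U : Set Z) : Prop :=
  ∃ z₀ : Z, ContinuousMap.Homotopic
    (⟨Subtype.val, continuous_subtype_val⟩ : C(U, Z)) (ContinuousMap.const U z₀)

/-- The Lusternik–Schnirelmann category, unnormalized convention (`cat(point) = 1`). -/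
def cat (X : Type*) [TopologicalSpace X] : ℕ∞ :=
  sInf {n : ℕ∞ | ∃ m : ℕ, n = (m : ℕ∞) ∧ ∃ U : Fin m → Set X,
    (∀ i, IsOpen (U i) ∧ NullhomotopicIncl (U i)) ∧ ∀ x : X, ∃ i, x ∈ U i}

/-- A continuous map is a d-map if it takes d-paths to d-paths. -/
def IsDMap (dX : DStruct X) (dY : DStruct Y) (f : C(X, Y)) : Prop :=
  ∀ γ ∈ dX.paths, f.comp γ ∈ dY.paths

/-- A d-homotopy from `f` to `g`: a continuous homotopy all of whose traces
`t ↦ H(x,t)` are d-paths in the target. -/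
def IsDHomotopy (dY : DStruct Y) (f g : C(X, Y)) (H : C(X × I, Y)) : Prop :=
  (∀ x, H (x, 0) = f x) ∧ (∀ x, H (x, 1) = g x) ∧
    ∀ x : X, H.comp ((ContinuousMap.const I x).prodMk (ContinuousMap.id I)) ∈ dY.paths

/-- Two d-maps are d-homotopic (from `f` to `g`). -/
def DHomotopic (dY : DStruct Y) (f g : C(X, Y)) : Prop :=
  ∃ H : C(X × I, Y), IsDHomotopy dY f g H

/-- A basic dihomotopy equivalence between d-spaces:
d-homotopy inverse d-maps `f, g` together with continuously graded maps `F, G` on the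
directed path spaces such that the induced maps on spaces of d-paths between fixed
endpoints are homotopy equivalences. -/
structure BasicDihomotopyEquiv {X : Type*} {Y : Type*} [TopologicalSpace X]
    [TopologicalSpace Y] (dX : DStruct X) (dY : DStruct Y) where
  f : C(X, Y)
  g : C(Y, X)
  f_dmap : IsDMap dX dY f
  g_dmap : IsDMap dY dX g
  gf_htpy : DHomotopic dX (g.comp f) (ContinuousMap.id X)
  fg_htpy : DHomotopic dY (f.comp g) (ContinuousMap.id Y)
  F : X → X → C(I, Y) → C(I, X)
  F_grade : ∀ x x', (x, x') ∈ dGamma dX →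
    ∀ γ ∈ dBetween dY (f x) (f x'), F x x' γ ∈ dBetween dX x x'
  F_cont : Continuous fun q : {q : (X × X) × C(I, Y) //
      q.1 ∈ dGamma dX ∧ q.2 ∈ dBetween dY (f q.1.1) (f q.1.2)} =>
    F q.1.1.1 q.1.1.2 q.1.2
  f_equiv : ∀ x x', (x, x') ∈ dGamma dX →
    ∃ (Φ : C(↥(dBetween dX x x'), ↥(dBetween dY (f x) (f x'))))
      (Ψ : C(↥(dBetween dY (f x) (f x')), ↥(dBetween dX x x'))),
      (∀ γ, (Φ γ : C(I, Y)) = f.comp (γ : C(I, X))) ∧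
      (∀ δ, (Ψ δ : C(I, X)) = F x x' (δ : C(I, Y))) ∧
      (Ψ.comp Φ).Homotopic (ContinuousMap.id _) ∧ (Φ.comp Ψ).Homotopic (ContinuousMap.id _)
  G : Y → Y → C(I, X) → C(I, Y)
  G_grade : ∀ y y', (y, y') ∈ dGamma dY →
    ∀ γ ∈ dBetween dX (g y) (g y'), G y y' γ ∈ dBetween dY y y'
  G_cont : Continuous fun q : {q : (Y × Y) × C(I, X) //
      q.1 ∈ dGamma dY ∧ q.2 ∈ dBetween dX (g q.1.1) (g q.1.2)} =>
    G q.1.1.1 q.1.1.2 q.1.2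
  g_equiv : ∀ y y', (y, y') ∈ dGamma dY →
    ∃ (Φ : C(↥(dBetween dY y y'), ↥(dBetween dX (g y) (g y'))))
      (Ψ : C(↥(dBetween dX (g y) (g y')), ↥(dBetween dY y y'))),
      (∀ γ, (Φ γ : C(I, X)) = g.comp (γ : C(I, Y))) ∧
      (∀ δ, (Ψ δ : C(I, Y)) = G y y' (δ : C(I, X))) ∧
      (Ψ.comp Φ).Homotopic (ContinuousMap.id _) ∧ (Φ.comp Ψ).Homotopic (ContinuousMap.id _)

/-- The one-point d-space. -/
def unitD : DStruct Unit where
  paths := Set.univ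
  const_mem := fun _ => trivial
  concat_mem := fun _ _ _ _ _ => trivial
  reparam_mem := fun _ _ _ _ => trivial

/-- A d-space is dicontractible if it is basic dihomotopy equivalent to a point. -/
def Dicontractible (dX : DStruct X) : Prop := Nonempty (BasicDihomotopyEquiv dX unitD)

/-- Product d-structure: paths whose coordinate projections are d-paths. -/
def DStruct.prod (dX : DStruct X) (dY : DStruct Y) : DStruct (X × Y) where
  paths := {γ | ContinuousMap.fst.comp γ ∈ dX.paths ∧ ContinuousMap.snd.comp γ ∈ dY.paths}
  const_mem x := by
    constructor
    · have : (ContinuousMap.fst.comp (ContinuousMap.const I x) : C(I, X)) =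
        ContinuousMap.const I x.1 := by ext t; rfl
      rw [this]; exact dX.const_mem x.1
    · have : (ContinuousMap.snd.comp (ContinuousMap.const I x) : C(I, Y)) =
        ContinuousMap.const I x.2 := by ext t; rfl
      rw [this]; exact dY.const_mem x.2
  concat_mem γ hγ δ hδ h := by
    constructor
    · rw [comp_concatCM]
      exact dX.concat_mem _ hγ.1 _ hδ.1 _
    · rw [comp_concatCM]
      exact dY.concat_mem _ hγ.2 _ hδ.2 _
  reparam_mem γ hγ φ hφ := by
    constructor
    · rw [← ContinuousMap.comp_assoc]
      exact dX.reparam_mem _ hγ.1 φ hφ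
    · rw [← ContinuousMap.comp_assoc]
      exact dY.reparam_mem _ hγ.2 φ hφ

/-- The continuous inclusion of a subset. -/
def inclCM {Z : Type*} [TopologicalSpace Z] (A : Set Z) : C(↥A, Z) :=
  ⟨Subtype.val, continuous_subtype_val⟩

/-- The d-structure induced on a subspace. -/
def DStruct.restrict (dX : DStruct X) (A : Set X) : DStruct ↥A where
  paths := {γ | (inclCM A).comp γ ∈ dX.paths}
  const_mem x := by
    have : ((inclCM A).comp (ContinuousMap.const I x) : C(I, X)) =
        ContinuousMap.const I (x : X) := by ext t; rfl
    simpa [Set.mem_setOf_eq, this] using dX.const_mem (x : X)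
  concat_mem γ hγ δ hδ h := by
    show (inclCM A).comp _ ∈ dX.paths
    rw [comp_concatCM]
    exact dX.concat_mem _ hγ _ hδ _
  reparam_mem γ hγ φ hφ := by
    show (inclCM A).comp _ ∈ dX.paths
    rw [← ContinuousMap.comp_assoc]
    exact dX.reparam_mem _ hγ φ hφ

/-- The directed interval `I⃗`: the unit interval with non-decreasing paths. -/
def dInterval : DStruct I where
  paths := {γ | Monotone ⇑γ}
  const_mem x := monotone_const
  concat_mem γ hγ δ hδ h := monotone_concatCM h hγ hδ
  reparam_mem γ hγ φ hφ := hγ.comp hφ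

/-- The directed homotopy lifting property of a d-map with respect to every d-space:
a d-fibration. -/
def IsDFibration {E B : Type*} [TopologicalSpace E] [TopologicalSpace B]
    (dE : DStruct E) (dB : DStruct B) (p : C(E, B)) : Prop :=
  IsDMap dE dB p ∧
  ∀ (X : Type) (_ : TopologicalSpace X) (dX : DStruct X) (f : C(X, E)) (φ : C(X × I, B)),
    IsDMap dX dE f → IsDMap (dX.prod dInterval) dB φ →
    ∀ α : I, (α = 0 ∨ α = 1) → (∀ x, φ (x, α) = p (f x)) →
    ∃ φ' : C(X × I, E), IsDMap (dX.prod dInterval) dE φ' ∧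
      (∀ q, p (φ' q) = φ q) ∧ ∀ x, φ' (x, α) = f x

/-- The (Hurewicz) homotopy lifting property with respect to every space: a fibration. -/
def IsFibration {E B : Type*} [TopologicalSpace E] [TopologicalSpace B] (p : C(E, B)) : Prop :=
  ∀ (X : Type) (_ : TopologicalSpace X) (f : C(X, E)) (φ : C(X × I, B)),
    (∀ x, φ (x, 0) = p (f x)) →
    ∃ φ' : C(X × I, E), (∀ q, p (φ' q) = φ q) ∧ ∀ x, φ' (x, 0) = f x

section Parametrized

variable {E B : Type*} [TopologicalSpace E] [TopologicalSpace B]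

/-- The fibre product `E ×_B E`. -/
def EBE (p : C(E, B)) : Set (E × E) := {q | p q.1 = p q.2}

/-- The space `dE_B` of d-paths in `E` lying in a single fibre of `p`. -/
def dEB (dE : DStruct E) (p : C(E, B)) : Set C(I, E) :=
  {γ | γ ∈ dE.paths ∧ ∃ b : B, ∀ t, p (γ t) = b}

/-- The set `Γ_{E,B}` of endpoint pairs of d-paths lying in a single fibre. -/
def GammaEB (dE : DStruct E) (p : C(E, B)) : Set (E × E) :=
  {q | ∃ γ ∈ dEB dE p, γ 0 = q.1 ∧ γ 1 = q.2}

/-- A subset of `E × E` admits a continuous section of the directed parametrized endpoint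
map `Π⃗ : dE_B → Γ_{E,B}`. -/
def DParamSecSet (dE : DStruct E) (p : C(E, B)) (U : Set (E × E)) : Prop :=
  ∃ s : U → C(I, E), Continuous s ∧
    ∀ u : U, s u ∈ dEB dE p ∧ (s u) 0 = u.1.1 ∧ (s u) 1 = u.1.2

/-- The directed parametrized topological complexity of a d-fibration `p : E → B`:
the smallest number of ENRs covering `Γ_{E,B}`, each admitting a continuous section of
the directed parametrized endpoint map. -/
def vTCp (dE : DStruct E) (p : C(E, B)) : ℕ∞ :=
  sInf {n : ℕ∞ | ∃ m : ℕ, n = (m : ℕ∞) ∧ ∃ U : Fin m → Set (E × E),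
    (∀ i, IsENRSet (U i) ∧ DParamSecSet dE p (U i)) ∧ GammaEB dE p ⊆ ⋃ i, U i}

/-- A subset of `E × E` admits a continuous section of the parametrized endpoint map
`Π : E^I_B → E ×_B E`. -/
def ParamSecSet (p : C(E, B)) (U : Set (E × E)) : Prop :=
  ∃ s : U → C(I, E), Continuous s ∧
    ∀ u : U, (∃ b : B, ∀ t, p ((s u) t) = b) ∧ (s u) 0 = u.1.1 ∧ (s u) 1 = u.1.2

/-- The parametrized topological complexity of a fibration `p : E → B` (Cohen–Farber–
Weinberger): the smallest number of relatively open subsets covering `E ×_B E`, each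
admitting a continuous section of the parametrized endpoint map. -/
def TCparam (p : C(E, B)) : ℕ∞ :=
  sInf {n : ℕ∞ | ∃ m : ℕ, n = (m : ℕ∞) ∧ ∃ U : Fin m → Set (E × E),
    (∀ i, U i ⊆ EBE p ∧ IsOpen (Subtype.val ⁻¹' (U i) : Set ↥(EBE p)) ∧ ParamSecSet p (U i)) ∧
    EBE p ⊆ ⋃ i, U i}

/-- The restriction of `p : E → B` to the preimage of a subset `B' ⊆ B`. -/
def restrictMap (p : C(E, B)) (B' : Set B) : C(↥(p ⁻¹' B'), ↥B') :=
  ⟨fun e => ⟨p e, e.2⟩, by fun_prop⟩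

/-- The d-structure `dE_B` on `E` formed by the fibrewise d-paths. -/
def dEBStruct (dE : DStruct E) (p : C(E, B)) : DStruct E where
  paths := dEB dE p
  const_mem x := ⟨dE.const_mem x, ⟨p x, fun _ => rfl⟩⟩
  concat_mem γ hγ δ hδ h := by
    obtain ⟨b, hb⟩ := hγ.2
    obtain ⟨b', hb'⟩ := hδ.2
    have hbb' : b = b' := by rw [← hb 1, ← hb' 0, h]
    refine ⟨dE.concat_mem _ hγ.1 _ hδ.1 _, ⟨b, fun t => ?_⟩⟩
    rw [concatCM_apply]
    split_ifs
    · exact hb _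
    · rw [hbb']; exact hb' _
  reparam_mem γ hγ φ hφ := by
    obtain ⟨b, hb⟩ := hγ.2
    exact ⟨dE.reparam_mem _ hγ.1 φ hφ, ⟨b, fun t => hb (φ t)⟩⟩

/-- The d-structure on the total space associated to a d-structure on the base of a
fibration: a path is directed iff its projection is directed. -/
def assocDStruct (dB : DStruct B) (p : C(E, B)) : DStruct E where
  paths := {γ | p.comp γ ∈ dB.paths}
  const_mem x := by
    have : (p.comp (ContinuousMap.const I x) : C(I, B)) = ContinuousMap.const I (p x) := by
      ext t; rfl
    simpa [Set.mem_setOf_eq, this] using dB.const_mem (p x)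
  concat_mem γ hγ δ hδ h := by
    show p.comp _ ∈ dB.paths
    rw [comp_concatCM]
    exact dB.concat_mem _ hγ _ hδ _
  reparam_mem γ hγ φ hφ := by
    show p.comp _ ∈ dB.paths
    rw [← ContinuousMap.comp_assoc]
    exact dB.reparam_mem _ hγ φ hφ

/-- A d-fibration is d-regular if `Γ_{E,B}` admits a partition realizing
`vTC[p : E → B]` into pairwise disjoint ENRs with continuous sections whose initial
unions are closed. -/
def IsRegularDFib (dE : DStruct E) (p : C(E, B)) : Prop :=
  ∃ n : ℕ, vTCp dE p = (n : ℕ∞) ∧ ∃ A : Fin n → Set (E × E),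
    (∀ i, IsENRSet (A i) ∧ DParamSecSet dE p (A i)) ∧
    (⋃ i, A i) = GammaEB dE p ∧
    (Pairwise fun i j => Disjoint (A i) (A j)) ∧
    ∀ r : Fin n, IsClosed (Subtype.val ⁻¹' (⋃ i, ⋃ (_ : i ≤ r), A i) : Set ↥(GammaEB dE p))

end Parametrized

/-- A d-space is regular if `Γ_X` admits a partition realizing `vTC(X)` into pairwise
disjoint ENRs with continuous sections whose initial unions are closed. -/
def IsRegularDSpace (dX : DStruct X) : Prop :=
  ∃ n : ℕ, vTC dX = (n : ℕ∞) ∧ ∃ A : Fin n → Set (X × X),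
    (∀ i, IsENRSet (A i) ∧ DSecSet dX (A i)) ∧
    (⋃ i, A i) = dGamma dX ∧
    (Pairwise fun i j => Disjoint (A i) (A j)) ∧
    ∀ r : Fin n, IsClosed (Subtype.val ⁻¹' (⋃ i, ⋃ (_ : i ≤ r), A i) : Set ↥(dGamma dX))

/-- The monotone d-structure on a subset of a (pre)ordered topological space: directed
paths are the paths that are non-decreasing (in each coordinate, for a pi-type order). -/
def monoDStruct {Z : Type*} [TopologicalSpace Z] [Preorder Z] (A : Set Z) : DStruct ↥A where
  paths := {γ | Monotone fun t => ((γ t : Z))}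
  const_mem x := fun _ _ _ => le_rfl
  concat_mem γ hγ δ hδ h := by
    have h' : (inclCM A).comp γ 1 = (inclCM A).comp δ 0 := by
      simp [inclCM, h]
    have : Monotone ⇑(concatCM ((inclCM A).comp γ) ((inclCM A).comp δ) h') :=
      monotone_concatCM h' hγ hδ
    have hcomp := comp_concatCM (inclCM A) γ δ h
    intro s t hst
    have := this hst
    rwa [← hcomp, ContinuousMap.comp_apply, ContinuousMap.comp_apply] at this
  reparam_mem γ hγ φ hφ := hγ.comp hφ

end

/-- The ordered configuration space `F(ℝ^k, m)` of `m` pairwise distinct points of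
`ℝ^k`, as a subset of `(ℝ^k)^m`. -/
def confSet (k m : ℕ) : Set (Fin m → Fin k → ℝ) := {z | Function.Injective z}

/-- The Fadell–Neuwirth fibration `F(ℝ^k, m+n) → F(ℝ^k, m)`, remembering the first `m`
points. -/
def FNmap (k m n : ℕ) : C(↥(confSet k (m + n)), ↥(confSet k m)) :=
  ⟨fun z => ⟨fun i => z.1 (Fin.castAdd n i), fun i j hij => by
      have h2 : Fin.castAdd n i = Fin.castAdd n j := z.2 hij
      exact Fin.ext (by simpa using congrArg Fin.val h2)⟩,
    by
      apply Continuous.subtype_mk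
      exact continuous_pi fun i => (continuous_apply (Fin.castAdd n i)).comp
        continuous_subtype_val⟩

/-! ### Cochains on streams of points -/

/-- The order embedding of `ℕ` into itself whose image misses exactly `i`. -/
def skipAt (i t : ℕ) : ℕ := if t < i then t else t + 1

lemma skipAt_of_lt {i t : ℕ} (h : t < i) : skipAt i t = t := if_pos h

lemma skipAt_of_le {i t : ℕ} (h : i ≤ t) : skipAt i t = t + 1 := if_neg h.not_gt

section Cochains

variable {T : Type*}

/-- The function `c` only depends on the entries of index at most `p`: it is a cochain of
degree `p`. -/
def IsCochain (p : ℕ) (c : (ℕ → T) → ℤ) : Prop :=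
  ∀ x y : ℕ → T, (∀ t ≤ p, x t = y t) → c x = c y

/-- The coboundary of a cochain of degree `p`. -/
def cobd (p : ℕ) (c : (ℕ → T) → ℤ) (x : ℕ → T) : ℤ :=
  ∑ i ∈ Finset.range (p + 2), (-1) ^ i * c (x ∘ skipAt i)

/-- The cup product of a cochain of degree `p` with another cochain. -/
def cup (p : ℕ) (a b : (ℕ → T) → ℤ) (x : ℕ → T) : ℤ := a x * b (fun t => x (p + t))

lemma IsCochain.cobd {p : ℕ} {c : (ℕ → T) → ℤ} (hc : IsCochain p c) :
    IsCochain (p + 1) (cobd p c) := by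
  intro x y h
  refine Finset.sum_congr rfl fun i _ => ?_
  rw [hc (x ∘ skipAt i) (y ∘ skipAt i)]
  intro t ht
  apply h
  unfold skipAt
  split_ifs <;> omega

lemma IsCochain.cup {p q : ℕ} {a b : (ℕ → T) → ℤ} (ha : IsCochain p a) (hb : IsCochain q b) :
    IsCochain (p + q) (cup p a b) := by
  intro x y h
  unfold _root_.cup
  rw [ha x y fun t ht => h t (by omega), hb _ _ fun t ht => h (p + t) (by omega)]

lemma cobd_cup {p q : ℕ} {a b : (ℕ → T) → ℤ} (ha : IsCochain p a) (x : ℕ → T) :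
    cobd (p + q) (cup p a b) x =
      cobd p a x * b (fun t => x (p + 1 + t)) +
        (-1) ^ p * a x * cobd q b (fun t => x (p + t)) := by
  have e1 : p + q + 2 = (p + 1) + (q + 1) := by ring
  unfold cobd
  rw [e1, Finset.sum_range_add, Finset.sum_range_succ (n := p + 1),
    Finset.sum_range_succ' (n := q + 1)]
  have h1 : ∀ i ∈ Finset.range (p + 1), (-1 : ℤ) ^ i * cup p a b (x ∘ skipAt i) =
      (-1) ^ i * a (x ∘ skipAt i) * b (fun t => x (p + 1 + t)) := by
    intro i hi
    rw [Finset.mem_range] at hi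
    have : (fun t => (x ∘ skipAt i) (p + t)) = fun t => x (p + 1 + t) := by
      funext t
      simp only [Function.comp_apply]
      rw [skipAt_of_le (by omega)]
      congr 1; omega
    unfold cup
    rw [this]; ring
  have h2 : ∀ i ∈ Finset.range (q + 1),
      (-1 : ℤ) ^ (p + 1 + i) * cup p a b (x ∘ skipAt (p + 1 + i)) =
      (-1) ^ p * a x * ((-1) ^ (i + 1) * b ((fun t => x (p + t)) ∘ skipAt (i + 1))) := by
    intro i _
    have e : a (x ∘ skipAt (p + 1 + i)) = a x :=
      ha _ _ fun t ht => by simp only [Function.comp_apply]; rw [skipAt_of_lt (by omega)]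
    have : (fun t => (x ∘ skipAt (p + 1 + i)) (p + t)) =
        (fun t => x (p + t)) ∘ skipAt (i + 1) := by
      funext t
      simp only [Function.comp_apply, skipAt]
      congr 1
      split_ifs <;> omega
    unfold cup
    rw [this, e]; ring
  have h3 : a (x ∘ skipAt (p + 1)) = a x :=
    ha _ _ fun t ht => by simp only [Function.comp_apply]; rw [skipAt_of_lt (by omega)]
  have h4 : (fun t => x (p + t)) ∘ skipAt 0 = fun t => x (p + 1 + t) := by
    funext t
    simp only [Function.comp_apply, skipAt]
    congr 1; simp; omega
  rw [Finset.sum_congr rfl h1, Finset.sum_congr rfl h2, h3, h4, ← Finset.sum_mul,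
    ← Finset.mul_sum]
  ring

lemma sum_alternating_eq_zero (F : ℕ → ℕ → ℤ) (hF : ∀ i j, j ≤ i → F (i + 1) j = -F j i) (n : ℕ) :
    ∑ i ∈ Finset.range (n + 1), ∑ j ∈ Finset.range n, F i j = 0 := by
  induction n with
  | zero => simp
  | succ n ih =>
    rw [Finset.sum_range_succ (n := n + 1)]
    have e1 : ∑ i ∈ Finset.range (n + 1), ∑ j ∈ Finset.range (n + 1), F i j =
        ∑ i ∈ Finset.range (n + 1), F i n := by
      rw [Finset.sum_congr rfl fun i _ => Finset.sum_range_succ (F i) n,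
        Finset.sum_add_distrib, ih, zero_add]
    rw [e1, ← Finset.sum_add_distrib]
    refine Finset.sum_eq_zero fun j hj => ?_
    rw [Finset.mem_range] at hj
    rw [hF n j (by omega)]; ring

lemma cobd_cobd {p : ℕ} (c : (ℕ → T) → ℤ) (x : ℕ → T) : cobd (p + 1) (cobd p c) x = 0 := by
  unfold cobd
  simp_rw [Finset.mul_sum]
  refine sum_alternating_eq_zero
    (fun i j => (-1) ^ i * ((-1) ^ j * c ((x ∘ skipAt i) ∘ skipAt j))) ?_ (p + 2)
  intro i j hij
  have : (x ∘ skipAt (i + 1)) ∘ skipAt j = (x ∘ skipAt j) ∘ skipAt i := by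
    funext t
    simp only [Function.comp_apply, skipAt]
    congr 1
    split_ifs <;> omega
  simp only [this]
  ring

lemma sum_prism (F G : ℕ → ℕ → ℤ) (D : ℕ → ℤ)
    (h1 : ∀ i j, j ≤ i → F (i + 1) j = -G i j) (h2 : ∀ i, F i i = D i)
    (h3 : ∀ i, F i (i + 1) = -D (i + 1)) (h4 : ∀ i j, i < j → F i (j + 1) = -G i j) (n : ℕ) :
    ∑ i ∈ Finset.range (n + 1), ∑ j ∈ Finset.range (n + 2), F i j =
      D 0 - D (n + 1) - ∑ i ∈ Finset.range n, ∑ j ∈ Finset.range (n + 1), G i j := by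
  induction n with
  | zero => simp [Finset.sum_range_succ, h2, h3]; ring
  | succ n ih =>
    rw [Finset.sum_range_succ (n := n + 1)]
    simp_rw [Finset.sum_range_succ (n := n + 2)]
    rw [Finset.sum_add_distrib, ih, Finset.sum_range_succ (n := n + 1), h2, h3]
    simp_rw [Finset.sum_range_succ (n := n + 1) (f := fun j => G _ j)]
    rw [Finset.sum_add_distrib, Finset.sum_range_succ (n := n)
      (f := fun i => ∑ j ∈ Finset.range (n + 1), G i j)]
    have e1 : ∑ x ∈ Finset.range (n + 1), F x (n + 2) =
        -∑ x ∈ Finset.range (n + 1), G x (n + 1) := by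
      rw [← Finset.sum_neg_distrib]
      exact Finset.sum_congr rfl fun i hi => h4 i (n + 1) (by simpa using hi)
    have e2 : ∑ x ∈ Finset.range (n + 1), F (n + 1) x =
        -∑ x ∈ Finset.range (n + 1), G n x := by
      rw [← Finset.sum_neg_distrib]
      exact Finset.sum_congr rfl fun i hi => h1 n i (by
        have := Finset.mem_range.1 hi; omega)
    rw [e1, e2]
    ring

variable {L : Type*}

/-- The stream `a x₀, …, a xᵢ, b xᵢ, b xᵢ₊₁, …`. -/
def prismStream (a b : T → L) (i : ℕ) (x : ℕ → T) (t : ℕ) : L :=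
  if t ≤ i then a (x t) else b (x (t - 1))

/-- The prism operator: a cochain whose coboundary compares the pull-backs along `a` and `b`. -/
def prismCochain (d : ℕ) (ω : (ℕ → L) → ℤ) (a b : T → L) (x : ℕ → T) : ℤ :=
  ∑ i ∈ Finset.range (d + 1), (-1) ^ i * ω (prismStream a b i x)

lemma isCochain_prismCochain {d : ℕ} {ω : (ℕ → L) → ℤ} (hω : IsCochain (d + 1) ω) (a b : T → L) :
    IsCochain d (prismCochain d ω a b) := by
  intro x y h
  refine Finset.sum_congr rfl fun i hi => ?_
  rw [Finset.mem_range] at hi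
  rw [hω (prismStream a b i x) (prismStream a b i y)]
  intro t ht
  unfold prismStream
  split_ifs with h'
  · rw [h t (by omega)]
  · rw [h (t - 1) (by omega)]

lemma cobd_prismCochain {d : ℕ} {ω : (ℕ → L) → ℤ} (hω : IsCochain (d + 1) ω) (a b : T → L)
    (x : ℕ → T) (hx : ∀ i, cobd (d + 1) ω (prismStream a b i x) = 0) :
    cobd d (prismCochain d ω a b) x = ω (b ∘ x) - ω (a ∘ x) := by
  have key := sum_prism
    (fun i j => (-1) ^ i * ((-1) ^ j * ω (prismStream a b i x ∘ skipAt j)))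
    (fun i j => (-1) ^ j * ((-1) ^ i * ω (prismStream a b i (x ∘ skipAt j))))
    (fun i => ω (fun t => if t < i then a (x t) else b (x t))) ?_ ?_ ?_ ?_ (d + 1)
  · have hz : ∑ i ∈ Finset.range (d + 1 + 1), ∑ j ∈ Finset.range (d + 1 + 2),
        (-1 : ℤ) ^ i * ((-1) ^ j * ω (prismStream a b i x ∘ skipAt j)) = 0 := by
      refine Finset.sum_eq_zero fun i _ => ?_
      rw [← Finset.mul_sum]
      have := hx i
      unfold cobd at this
      rw [this, mul_zero]
    rw [hz, Finset.sum_comm] at key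
    have e0 : (fun t => if t < 0 then a (x t) else b (x t)) = b ∘ x := by
      funext t; simp
    have e1 : ω (fun t => if t < d + 1 + 1 then a (x t) else b (x t)) = ω (a ∘ x) :=
      hω _ _ fun t ht => by rw [if_pos (by omega)]; rfl
    rw [e0, e1] at key
    unfold cobd prismCochain
    simp_rw [Finset.mul_sum]
    linarith
  · intro i j hij
    have : prismStream a b (i + 1) x ∘ skipAt j = prismStream a b i (x ∘ skipAt j) := by
      funext t
      simp only [Function.comp_apply, prismStream, skipAt]
      split_ifs <;> first | rfl | omega | (congr 2; omega)
    simp only [this]; ring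
  · intro i
    have : prismStream a b i x ∘ skipAt i = fun t => if t < i then a (x t) else b (x t) := by
      funext t
      simp only [Function.comp_apply, prismStream, skipAt]
      split_ifs <;> first | rfl | omega
    simp only [this]
    rw [← mul_assoc, ← mul_pow]; simp
  · intro i
    have : prismStream a b i x ∘ skipAt (i + 1) =
        fun t => if t < i + 1 then a (x t) else b (x t) := by
      funext t
      simp only [Function.comp_apply, prismStream, skipAt]
      split_ifs <;> first | rfl | omega
    simp only [this]
    rw [← mul_assoc, pow_succ, ← mul_assoc, ← mul_pow]; simp
  · intro i j hij
    have : prismStream a b i x ∘ skipAt (j + 1) = prismStream a b i (x ∘ skipAt j) := by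
      funext t
      simp only [Function.comp_apply, prismStream, skipAt]
      split_ifs <;> first | rfl | omega | (congr 2; omega)
    simp only [this]; ring

/-- The product of the cochains `v 0, …, v (n - 1)`, all of degree `d`. -/
def cupPow (d : ℕ) (v : ℕ → (ℕ → T) → ℤ) (n : ℕ) (x : ℕ → T) : ℤ :=
  ∏ j ∈ Finset.range n, v j (fun t => x (d * j + t))

lemma cupPow_succ (d : ℕ) (v : ℕ → (ℕ → T) → ℤ) (n : ℕ) :
    cupPow d v (n + 1) = cup (d * n) (cupPow d v n) (v n) := by
  funext x
  exact Finset.prod_range_succ _ _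

lemma isCochain_cupPow {d : ℕ} {v : ℕ → (ℕ → T) → ℤ} (hv : ∀ j, IsCochain d (v j)) (n : ℕ) :
    IsCochain (d * n) (cupPow d v n) := by
  induction n with
  | zero => intro x y _; simp [cupPow]
  | succ n ih => rw [cupPow_succ, Nat.mul_succ]; exact ih.cup (hv n)

lemma cobd_cupPow {d : ℕ} {v : ℕ → (ℕ → T) → ℤ} (hv : ∀ j, IsCochain d (v j))
    {P : Set (ℕ → T)} (hP : ∀ x ∈ P, ∀ φ : ℕ → ℕ, x ∘ φ ∈ P)
    (hv0 : ∀ j, ∀ x ∈ P, cobd d (v j) x = 0) (n : ℕ) :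
    ∀ x ∈ P, cobd (d * n) (cupPow d v n) x = 0 := by
  induction n with
  | zero => intro x _; simp [cobd, cupPow, Finset.sum_range_succ]
  | succ n ih =>
    intro x hx
    rw [cupPow_succ, Nat.mul_succ, cobd_cup (isCochain_cupPow hv n), ih x hx,
      hv0 n _ (show (fun t => x (d * n + t)) ∈ P from hP x hx fun t => d * n + t)]
    ring

/-- Replacing closed cochains by cohomologous ones changes their product by a coboundary. -/
lemma cupPow_cohomologous {d : ℕ} {v η : ℕ → (ℕ → T) → ℤ} (hv : ∀ j, IsCochain (d + 1) (v j))
    (hη : ∀ j, IsCochain d (η j)) {P : Set (ℕ → T)}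
    (hP : ∀ x ∈ P, ∀ φ : ℕ → ℕ, x ∘ φ ∈ P)
    (hv0 : ∀ j, ∀ x ∈ P, cobd (d + 1) (v j) x = 0) (n : ℕ) :
    ∃ ζ : (ℕ → T) → ℤ, IsCochain ((d + 1) * (n + 1) - 1) ζ ∧ ∀ x ∈ P,
      cupPow (d + 1) (fun j x => v j x - cobd d (η j) x) (n + 1) x =
        cupPow (d + 1) v (n + 1) x + cobd ((d + 1) * (n + 1) - 1) ζ x := by
  set v' : ℕ → (ℕ → T) → ℤ := fun j x => v j x - cobd d (η j) x with hv'
  have hvc : ∀ j, IsCochain (d + 1) (v' j) := fun j x y h => by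
    simp only [hv', hv j x y h, (hη j).cobd x y h]
  have cobd_sub : ∀ j x, cobd (d + 1) (v' j) x = cobd (d + 1) (v j) x := fun j x => by
    have h := cobd_cobd (p := d) (η j) x
    unfold cobd at h ⊢
    simp only [hv', mul_sub, Finset.sum_sub_distrib]
    unfold cobd
    rw [h, sub_zero]
  have hv'0 : ∀ j, ∀ x ∈ P, cobd (d + 1) (v' j) x = 0 := fun j x hx => by
    rw [cobd_sub, hv0 j x hx]
  induction n with
  | zero =>
    refine ⟨fun x => -η 0 x, fun x y h => congrArg Neg.neg (hη 0 x y (by simpa using h)), fun x _ => ?_⟩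
    simp [cupPow, hv', cobd, sub_eq_add_neg]
  | succ n ih =>
    obtain ⟨ζ, hζ, hζx⟩ := ih
    set p := (d + 1) * (n + 1) - 1 with hp
    have hp1 : (d + 1) * (n + 1) = p + 1 := by
      have : 0 < (d + 1) * (n + 1) := by positivity
      omega
    have hp2 : (d + 1) * (n + 1 + 1) - 1 = p + (d + 1) := by
      rw [Nat.mul_succ]; omega
    rw [hp2]
    refine ⟨fun x => cup p ζ (v' (n + 1)) x -
      (-1) ^ (p + 1) * cup (p + 1) (cupPow (d + 1) v (n + 1)) (η (n + 1)) x, ?_, fun x hx => ?_⟩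
    · intro x y h
      have h1 := (hζ.cup (hvc (n + 1))) x y h
      have h2 := (((isCochain_cupPow hv (n + 1)).cup (hη (n + 1)))) x y
        (fun t ht => h t (by omega))
      rw [hp1] at h2
      simp only [h1, h2]
    · rw [cupPow_succ _ v', cupPow_succ _ v, hp1]
      have hc := isCochain_cupPow hv (n + 1)
      rw [hp1] at hc
      have h1 := cobd_cup (q := d + 1) (b := v' (n + 1)) hζ x
      have h2 := cobd_cup (q := d) (b := η (n + 1)) hc x
      have h3 := cobd_cupPow hv hP hv0 (n + 1) x hx
      rw [hp1] at h3
      rw [h3] at h2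
      rw [hv'0 (n + 1) _ (show (fun t => x (p + t)) ∈ P from hP x hx fun t => p + t)] at h1
      have h4 : cobd (p + (d + 1)) (fun x => cup p ζ (v' (n + 1)) x -
          (-1) ^ (p + 1) * cup (p + 1) (cupPow (d + 1) v (n + 1)) (η (n + 1)) x) x =
          cobd (p + (d + 1)) (cup p ζ (v' (n + 1))) x - (-1) ^ (p + 1) *
          cobd (p + 1 + d) (cup (p + 1) (cupPow (d + 1) v (n + 1)) (η (n + 1))) x := by
        have : p + (d + 1) = p + 1 + d := by ring
        unfold cobd
        rw [this, Finset.mul_sum, ← Finset.sum_sub_distrib]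
        exact Finset.sum_congr rfl fun i _ => by ring
      rw [h4, h1, h2]
      have h5 := hζx x hx
      unfold cup
      rw [h5]
      have h6 : ((-1 : ℤ) ^ (p + 1)) * (-1) ^ (p + 1) = 1 := by
        rw [← mul_pow]; simp
      simp only [hv']
      linear_combination (cupPow (d + 1) v (n + 1) x * cobd d (η (n + 1))
        (fun t => x (p + 1 + t))) * h6

end Cochains

/-! ### Sign labels and the orientation cochain -/

/-- The least index of a negative coordinate of `v`, or `n` if there is none. -/
noncomputable def negLabel {n : ℕ} (v : Fin n → ℝ) : ℕ :=
  sInf {i | i = n ∨ ∃ j : Fin n, (j : ℕ) = i ∧ v j < 0}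

lemma negLabel_mem {n : ℕ} (v : Fin n → ℝ) :
    negLabel v = n ∨ ∃ j : Fin n, (j : ℕ) = negLabel v ∧ v j < 0 :=
  Nat.sInf_mem (s := {i | i = n ∨ ∃ j : Fin n, (j : ℕ) = i ∧ v j < 0}) ⟨n, Or.inl rfl⟩

lemma negLabel_le {n : ℕ} (v : Fin n → ℝ) : negLabel v ≤ n := Nat.sInf_le (Or.inl rfl)

lemma negLabel_le_of_neg {n : ℕ} {v : Fin n → ℝ} {j : Fin n} (h : v j < 0) : negLabel v ≤ j :=
  Nat.sInf_le (Or.inr ⟨j, rfl, h⟩)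

lemma nonneg_of_lt_negLabel {n : ℕ} {v : Fin n → ℝ} {j : Fin n} (h : (j : ℕ) < negLabel v) :
    0 ≤ v j := by
  by_contra! h'
  exact absurd (negLabel_le_of_neg h') (by omega)

lemma neg_of_negLabel_eq {n : ℕ} {v : Fin n → ℝ} {j : Fin n} (h : negLabel v = j) : v j < 0 := by
  rcases negLabel_mem v with h' | ⟨i, hi, hv⟩
  · have := j.2; omega
  · rwa [Fin.ext (hi.trans h)] at hv

lemma negLabel_mono {n : ℕ} {v w : Fin n → ℝ} (h : v ≤ w) : negLabel v ≤ negLabel w := by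
  rcases negLabel_mem w with h' | ⟨i, hi, hv⟩
  · rw [h']; exact negLabel_le v
  · rw [← hi]; exact negLabel_le_of_neg ((h i).trans_lt hv)

/-- Vectors in a ball around `c` missing the origin also miss a label. -/
lemma exists_negLabel_ne {n : ℕ} (c : Fin n → ℝ) :
    ∃ q ≤ n, ∀ v, ‖v - c‖ < ‖c‖ → negLabel v ≠ q := by
  by_cases hc : ∃ i, |c i| = ‖c‖
  · obtain ⟨i, hi⟩ := hc
    have key : ∀ v : Fin n → ℝ, ‖v - c‖ < ‖c‖ → |v i - c i| < |c i| := fun v hv => by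
      rw [hi]; exact (norm_le_pi_norm (v - c) i).trans_lt hv
    rcases le_total 0 (c i) with h | h
    · refine ⟨i, i.2.le, fun v hv hq => ?_⟩
      have h1 := neg_of_negLabel_eq hq
      have h2 := key v hv
      rw [abs_of_nonneg h, abs_lt] at h2
      linarith [h2.1]
    · refine ⟨n, le_rfl, fun v hv hq => ?_⟩
      have h2 := key v hv
      rw [abs_of_nonpos h, abs_lt] at h2
      have := negLabel_le_of_neg (v := v) (j := i) (by linarith [h2.2])
      have := i.2
      omega
  · refine ⟨n, le_rfl, fun v hv => ?_⟩
    exfalso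
    rcases isEmpty_or_nonempty (Fin n) with h | h
    · rw [Subsingleton.elim c 0, norm_zero] at hv
      exact absurd hv (norm_nonneg _).not_gt
    · obtain ⟨i, hi⟩ := Finite.exists_max fun i => |c i|
      refine hc ⟨i, le_antisymm (norm_le_pi_norm c i) ?_⟩
      exact (pi_norm_le_iff_of_nonneg (abs_nonneg _)).2 hi

/-- The cochain of degree `d` on streams of labels which picks out the permutations of the
labels `1, …, d + 1` with their signs. -/
noncomputable def orient (d : ℕ) (l : ℕ → ℕ) : ℤ :=
  Matrix.det (Matrix.of fun i j : Fin (d + 1) => if l i = j + 1 then (1 : ℤ) else 0)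

lemma isCochain_orient (d : ℕ) : IsCochain d (orient d) := by
  intro x y h
  unfold orient
  congr 1
  ext i j
  simp only [Matrix.of_apply]
  rw [h i (by omega)]

lemma orient_eq_zero_of_eq {d : ℕ} {l : ℕ → ℕ} {s t : ℕ} (hs : s ≤ d) (ht : t ≤ d) (hst : s ≠ t)
    (h : l s = l t) : orient d l = 0 := by
  refine Matrix.det_zero_of_row_eq (i := ⟨s, by omega⟩) (j := ⟨t, by omega⟩)
    (by simpa using hst) ?_
  funext j
  simp [h]

lemma orient_eq_zero_of_label_zero {d : ℕ} {l : ℕ → ℕ} {t : ℕ} (ht : t ≤ d) (h : l t = 0) :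
    orient d l = 0 := by
  refine Matrix.det_eq_zero_of_row_eq_zero ⟨t, by omega⟩ fun j => ?_
  simp [h]

lemma orient_eq_one {d : ℕ} {l : ℕ → ℕ} (h : ∀ t ≤ d, l t = t + 1) : orient d l = 1 := by
  have : (Matrix.of fun i j : Fin (d + 1) => if l i = j + 1 then (1 : ℤ) else 0) = 1 := by
    ext i j
    simp only [Matrix.of_apply, Matrix.one_apply]
    rw [h i (by omega)]
    simp [Fin.ext_iff]
  rw [orient, this, Matrix.det_one]

lemma cobd_orient {d : ℕ} (l : ℕ → ℕ) : cobd d (orient d) l =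
    Matrix.det (Matrix.of fun i j : Fin (d + 2) =>
      if j = 0 then (1 : ℤ) else if l i = j then 1 else 0) := by
  rw [Matrix.det_succ_column_zero, cobd, Finset.sum_range]
  refine Finset.sum_congr rfl fun i _ => ?_
  simp only [Matrix.of_apply, if_true, mul_one]
  congr 1
  unfold orient
  congr 1
  ext s j
  simp only [Matrix.of_apply, Matrix.submatrix_apply, Function.comp_apply, Fin.succ_ne_zero,
    if_false, Fin.val_succ]
  have : skipAt i s = (i.succAbove s : ℕ) := by
    unfold skipAt Fin.succAbove
    simp only [Fin.lt_def, Fin.val_castSucc]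
    split_ifs <;> simp
  simp only [this]

lemma cobd_orient_eq_zero {d : ℕ} {l : ℕ → ℕ} (hl : ∀ t, l t ≤ d + 1) {q : ℕ} (hq : q ≤ d + 1)
    (h : ∀ t, l t ≠ q) : cobd d (orient d) l = 0 := by
  obtain ⟨i, -, j, -, hij, heq⟩ := Finset.exists_ne_map_eq_of_card_lt_of_maps_to
    (s := (Finset.univ : Finset (Fin (d + 2)))) (t := (Finset.range (d + 2)).erase q)
    (f := fun i => l i) (by
      rw [Finset.card_erase_of_mem (by simp; omega)]; simp)
    (fun i _ => by
      simp only [Finset.coe_erase, Finset.coe_range, Set.mem_sdiff, Set.mem_Iio,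
        Set.mem_singleton_iff]
      exact ⟨by have := hl i; omega, h i⟩)
  rw [cobd_orient]
  refine Matrix.det_zero_of_row_eq hij ?_
  funext s
  simp only [Matrix.of_apply]
  rw [show l i = l j from heq]

/-! ### Integration over a triangulated torus -/

section Grid

variable {D L : ℕ}

/-- The vertices of the simplex of the cube with lowest corner `c` attached to the order `π` of
the coordinates: the coordinate `a` is increased at time `π a`. -/
def gridPath (c : Fin D → ZMod L) (π : Equiv.Perm (Fin D)) (t : ℕ) (a : Fin D) : ZMod L :=
  c a + if (π a : ℕ) < t then 1 else 0

/-- The evaluation of a cochain on the fundamental cycle of the triangulated torus. -/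
def gridInt [NeZero L] (φ : (ℕ → Fin D → ZMod L) → ℤ) : ℤ :=
  ∑ c : Fin D → ZMod L, ∑ π : Equiv.Perm (Fin D), (Equiv.Perm.sign π : ℤ) * φ (gridPath c π)

lemma gridPath_swap_mul (c : Fin D → ZMod L) (π : Equiv.Perm (Fin D)) {i j : Fin D}
    (hij : (j : ℕ) = i + 1) {t : ℕ} (ht : t ≠ j) :
    gridPath c (Equiv.swap i j * π) t = gridPath c π t := by
  funext a
  have : (((Equiv.swap i j * π) a : ℕ) < t) ↔ ((π a : ℕ) < t) := by
    rw [Equiv.Perm.mul_apply, Equiv.swap_apply_def]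
    split_ifs with h1 h2
    · rw [h1]; omega
    · rw [h2]; omega
    · rfl
  simp only [gridPath, this]

lemma gridPath_succ {n : ℕ} (c : Fin (n + 1) → ZMod L) (π : Equiv.Perm (Fin (n + 1))) {t : ℕ}
    (ht : t ≤ n) : gridPath c (finRotate (n + 1) * π) (t + 1) =
      gridPath (c + Pi.single (π.symm (Fin.last n)) 1) π t := by
  funext a
  simp only [gridPath, Equiv.Perm.mul_apply, Pi.add_apply, Pi.single_apply]
  by_cases h : π a = Fin.last n
  · have h' : a = π.symm (Fin.last n) := by rw [← h]; simp
    simp [h, ← h', ht]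
  · have h' : a ≠ π.symm (Fin.last n) := fun h' => h (by rw [h']; simp)
    have h2 : ((finRotate (n + 1) (π a) : Fin (n + 1)) : ℕ) = π a + 1 :=
      coe_finRotate_of_ne_last h
    simp only [h2, h', if_false, add_zero, Nat.add_lt_add_iff_right]

lemma gridInt_cobd [NeZero L] {n : ℕ} {η : (ℕ → Fin (n + 1) → ZMod L) → ℤ} (hη : IsCochain n η) :
    gridInt (cobd n η) = 0 := by
  set J : ℕ → ℤ := fun i => ∑ c : Fin (n + 1) → ZMod L, ∑ π : Equiv.Perm (Fin (n + 1)),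
    (Equiv.Perm.sign π : ℤ) * η (gridPath c π ∘ skipAt i) with hJ
  have h0 : gridInt (cobd n η) = ∑ i ∈ Finset.range (n + 2), (-1) ^ i * J i := by
    simp only [gridInt, cobd, hJ, Finset.mul_sum]
    rw [Finset.sum_congr rfl fun c _ => Finset.sum_comm, Finset.sum_comm]
    refine Finset.sum_congr rfl fun i _ => Finset.sum_congr rfl fun c _ =>
      Finset.sum_congr rfl fun π _ => by ring
  have hmid : ∀ i ∈ Finset.range n, (-1) ^ (i + 1) * J (i + 1) = 0 := by
    intro i hi
    rw [Finset.mem_range] at hi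
    have : J (i + 1) = -J (i + 1) := by
      simp only [hJ]
      rw [← Finset.sum_neg_distrib]
      refine Finset.sum_congr rfl fun c _ => ?_
      rw [← Finset.sum_neg_distrib]
      refine Fintype.sum_equiv (Equiv.mulLeft (Equiv.swap ⟨i, by omega⟩ ⟨i + 1, by omega⟩)) _ _
        fun π => ?_
      have e : gridPath c (Equiv.swap ⟨i, by omega⟩ ⟨i + 1, by omega⟩ * π) ∘ skipAt (i + 1) =
          gridPath c π ∘ skipAt (i + 1) := by
        funext t
        refine gridPath_swap_mul c π rfl ?_
        simp only [skipAt]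
        split_ifs <;> omega
      rw [Equiv.coe_mulLeft, e, Equiv.Perm.sign_mul, Equiv.Perm.sign_swap (by simp)]
      simp
    rw [show J (i + 1) = 0 by omega, mul_zero]
  have hend : J 0 = (-1) ^ n * J (n + 1) := by
    simp only [hJ, Finset.mul_sum]
    rw [Finset.sum_comm, Finset.sum_comm (s := (Finset.univ : Finset (Fin (n + 1) → ZMod L)))]
    refine (Fintype.sum_equiv (Equiv.mulLeft (finRotate (n + 1))) _ _ fun π => ?_).symm
    refine (Fintype.sum_equiv (Equiv.subRight (Pi.single (π.symm (Fin.last n)) 1)) _ _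
      fun c => ?_)
    have e : η (gridPath (c - Pi.single (π.symm (Fin.last n)) 1) (finRotate (n + 1) * π) ∘
        skipAt 0) = η (gridPath c π ∘ skipAt (n + 1)) := by
      refine hη _ _ fun t ht => ?_
      simp only [Function.comp_apply]
      rw [skipAt_of_le (by omega), skipAt_of_lt (by omega), gridPath_succ _ _ ht, sub_add_cancel]
    rw [Equiv.coe_mulLeft, Equiv.subRight_apply, e, Equiv.Perm.sign_mul, sign_finRotate]
    push_cast
    ring
  rw [h0, Finset.sum_range_succ, Finset.sum_range_succ', Finset.sum_eq_zero hmid, hend]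
  ring

end Grid

/-! ### A map of degree one from the torus to a product of spheres -/

/-- The unit sphere of `ℝ ^ n` for the supremum norm. -/
abbrev SupSphere (n : ℕ) : Type := Metric.sphere (0 : Fin n → ℝ) 1

lemma SupSphere.ne_zero {n : ℕ} (x : SupSphere n) : (x : Fin n → ℝ) ≠ 0 := by
  intro h
  have := mem_sphere_zero_iff_norm.1 x.2
  rw [h, norm_zero] at this
  exact zero_ne_one this

/-- A map collapsing everything outside the unit cube to a single ray. -/
noncomputable def foldVec {d : ℕ} (x : Fin d → ℝ) : Fin (d + 1) → ℝ :=
  Fin.cons (1 - 2 * min ‖x‖ 1) ((1 - min ‖x‖ 1) • x)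

lemma continuous_foldVec {d : ℕ} : Continuous (foldVec : (Fin d → ℝ) → _) := by
  refine continuous_pi fun i => ?_
  refine Fin.cases ?_ (fun j => ?_) i
  · simp only [foldVec, Fin.cons_zero]; fun_prop
  · simp only [foldVec, Fin.cons_succ]; fun_prop

lemma foldVec_ne_zero {d : ℕ} (x : Fin d → ℝ) : foldVec x ≠ 0 := by
  intro h
  have h0 := congrFun h 0
  have h1 : (1 - min ‖x‖ 1) • x = 0 := by
    funext j
    have := congrFun h j.succ
    simpa [foldVec] using this
  simp only [foldVec, Fin.cons_zero, Pi.zero_apply] at h0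
  rcases smul_eq_zero.1 h1 with h2 | h2
  · linarith
  · rw [h2, norm_zero, min_eq_left zero_le_one] at h0; linarith

lemma foldVec_eq_of_one_le {d : ℕ} {x y : Fin d → ℝ} (hx : 1 ≤ ‖x‖) (hy : 1 ≤ ‖y‖) :
    foldVec x = foldVec y := by
  simp [foldVec, hx, hy]

/-- The normalization of `foldVec`. -/
noncomputable def foldMap {d : ℕ} (x : Fin d → ℝ) : SupSphere (d + 1) :=
  ⟨‖foldVec x‖⁻¹ • foldVec x, by
    rw [mem_sphere_zero_iff_norm, norm_smul, norm_inv, norm_norm,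
      inv_mul_cancel₀ (norm_ne_zero_iff.2 (foldVec_ne_zero x))]⟩

lemma continuous_foldMap {d : ℕ} : Continuous (foldMap : (Fin d → ℝ) → _) := by
  refine Continuous.subtype_mk ?_ _
  exact (continuous_foldVec.norm.inv₀ fun x => norm_ne_zero_iff.2 (foldVec_ne_zero x)).smul
    continuous_foldVec

lemma foldMap_eq_of_one_le {d : ℕ} {x y : Fin d → ℝ} (hx : 1 ≤ ‖x‖) (hy : 1 ≤ ‖y‖) :
    foldMap x = foldMap y := by
  simp only [foldMap, foldVec_eq_of_one_le hx hy]

lemma negLabel_smul {n : ℕ} {a : ℝ} (ha : 0 < a) (v : Fin n → ℝ) :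
    negLabel (a • v) = negLabel v := by
  simp only [negLabel, Pi.smul_apply, smul_eq_mul, mul_neg_iff, ha, ha.not_gt, true_and,
    false_and, or_false]

lemma negLabel_cons_of_neg {n : ℕ} {a : ℝ} (ha : a < 0) (v : Fin n → ℝ) :
    negLabel (Fin.cons a v : Fin (n + 1) → ℝ) = 0 :=
  Nat.le_zero.1 (negLabel_le_of_neg (j := (0 : Fin (n + 1))) (by simpa using ha))

lemma negLabel_cons_of_nonneg {n : ℕ} {a : ℝ} (ha : 0 ≤ a) (v : Fin n → ℝ) :
    negLabel (Fin.cons a v : Fin (n + 1) → ℝ) = negLabel v + 1 := by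
  apply le_antisymm
  · rcases negLabel_mem v with h | ⟨j, hj, hv⟩
    · rw [h]; exact negLabel_le _
    · rw [← hj]
      exact negLabel_le_of_neg (j := j.succ) (by simpa using hv)
  · rcases negLabel_mem (Fin.cons a v : Fin (n + 1) → ℝ) with h | ⟨j, hj, hv⟩
    · rw [h]; exact Nat.succ_le_succ (negLabel_le v)
    · rw [← hj]
      revert hv
      refine Fin.cases (fun h => ?_) (fun i h => ?_) j
      · simp only [Fin.cons_zero] at h; linarith
      · simp only [Fin.cons_succ] at h
        simpa using negLabel_le_of_neg h

lemma negLabel_foldMap {d : ℕ} (x : Fin d → ℝ) : negLabel (foldMap x : Fin (d + 1) → ℝ) =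
    if ‖x‖ ≤ 1 / 2 then negLabel x + 1 else 0 := by
  have h : 0 < ‖foldVec x‖⁻¹ := inv_pos.2 (norm_pos_iff.2 (foldVec_ne_zero x))
  rw [foldMap, negLabel_smul h, foldVec]
  split_ifs with hx
  · have hm : min ‖x‖ 1 = ‖x‖ := min_eq_left (by linarith)
    rw [negLabel_cons_of_nonneg (by rw [hm]; linarith), negLabel_smul (by rw [hm]; linarith)]
  · apply negLabel_cons_of_neg
    have : 1 / 2 < min ‖x‖ 1 := lt_min (not_le.1 hx) (by norm_num)
    linarith

section GridMap

variable {N d L : ℕ}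

/-- The real coordinates, in `[-1, 1]`, of a vertex of the grid. -/
noncomputable def gridVec (c : Fin (N * d) → ZMod L) (j : Fin N) (i : Fin d) : ℝ :=
  2 * (c (finProdFinEquiv (j, i))).val / L - 1

/-- The map from the grid to a product of spheres. -/
noncomputable def gridMap (c : Fin (N * d) → ZMod L) (j : Fin N) : SupSphere (d + 1) :=
  foldMap (gridVec c j)

lemma gridPath_succ_of_ne {D : ℕ} (c : Fin D → ZMod L) (π : Equiv.Perm (Fin D)) {t : ℕ}
    {a : Fin D} (h : (π a : ℕ) ≠ t) : gridPath c π (t + 1) a = gridPath c π t a := by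
  have : ((π a : ℕ) < t + 1) ↔ ((π a : ℕ) < t) := by omega
  simp only [gridPath, this]

/-- The coordinates of a simplex of the grid before identification of opposite sides. -/
noncomputable def gridLift (c : Fin (N * d) → ZMod L) (π : Equiv.Perm (Fin (N * d))) (t : ℕ)
    (j : Fin N) (i : Fin d) : ℝ :=
  gridVec c j i + if (π (finProdFinEquiv (j, i)) : ℕ) < t then 2 / (L : ℝ) else 0

lemma gridVec_mem [NeZero L] (c : Fin (N * d) → ZMod L) (j : Fin N) (i : Fin d) :
    -1 ≤ gridVec c j i ∧ gridVec c j i + 2 / L ≤ 1 := by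
  have hL : (0 : ℝ) < L := by exact_mod_cast Nat.pos_of_neZero L
  have h : ((c (finProdFinEquiv (j, i))).val : ℝ) + 1 ≤ L := by
    exact_mod_cast ZMod.val_lt (c (finProdFinEquiv (j, i)))
  constructor
  · have : 0 ≤ 2 * ((c (finProdFinEquiv (j, i))).val : ℝ) / L := by positivity
    unfold gridVec; linarith
  · have : gridVec c j i + 2 / L = 2 * (((c (finProdFinEquiv (j, i))).val : ℝ) + 1) / L - 1 := by
      unfold gridVec; ring
    rw [this]
    have : 2 * (((c (finProdFinEquiv (j, i))).val : ℝ) + 1) / L ≤ 2 := by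
      rw [div_le_iff₀ hL]; linarith
    linarith

lemma gridLift_mem [NeZero L] (c : Fin (N * d) → ZMod L) (π : Equiv.Perm (Fin (N * d))) (t : ℕ)
    (j : Fin N) : gridLift c π t j ∈ Metric.closedBall (0 : Fin d → ℝ) 1 := by
  rw [mem_closedBall_zero_iff, pi_norm_le_iff_of_nonneg zero_le_one]
  intro i
  have h := gridVec_mem c j i
  have hL : (0 : ℝ) ≤ 2 / L := by positivity
  rw [Real.norm_eq_abs, abs_le, gridLift]
  split_ifs <;> constructor <;> linarith

/-- A coordinate either is the coordinate of the lift or has been wrapped from `1` to `-1`. -/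
lemma gridVec_gridPath [NeZero L] (hL : 1 < L) (c : Fin (N * d) → ZMod L)
    (π : Equiv.Perm (Fin (N * d))) (t : ℕ) (j : Fin N) (i : Fin d) :
    gridVec (gridPath c π t) j i = gridLift c π t j i ∨
      gridVec (gridPath c π t) j i = -1 ∧ gridLift c π t j i = 1 := by
  have hL0 : (L : ℝ) ≠ 0 := by exact_mod_cast NeZero.ne L
  have : Fact (1 < L) := ⟨hL⟩
  unfold gridLift gridVec gridPath
  split_ifs with h
  · have h1 : ((1 : ZMod L)).val = 1 := ZMod.val_one L
    rcases lt_or_ge ((c (finProdFinEquiv (j, i))).val + 1) L with h2 | h2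
    · left
      rw [ZMod.val_add_of_lt (by rw [h1]; exact h2), h1]
      push_cast; ring
    · right
      have h3 : (c (finProdFinEquiv (j, i))).val + 1 = L :=
        le_antisymm (ZMod.val_lt _) h2
      have h4 : c (finProdFinEquiv (j, i)) + 1 = 0 := by
        rw [← ZMod.natCast_zmod_val (c (finProdFinEquiv (j, i))), ← Nat.cast_one,
          ← Nat.cast_add, h3, ZMod.natCast_self]
      rw [h4, ZMod.val_zero]
      refine ⟨by simp, ?_⟩
      have h5 : ((c (finProdFinEquiv (j, i))).val : ℝ) = L - 1 := by
        rw [eq_sub_iff_add_eq]; exact_mod_cast h3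
      rw [h5]; field_simp; ring
  · left; simp

lemma gridMap_gridPath [NeZero L] (hL : 1 < L) (c : Fin (N * d) → ZMod L)
    (π : Equiv.Perm (Fin (N * d))) (t : ℕ) (j : Fin N) :
    gridMap (gridPath c π t) j = foldMap (gridLift c π t j) := by
  by_cases h : ∃ i, gridVec (gridPath c π t) j i = -1 ∧ gridLift c π t j i = 1
  · obtain ⟨i, h1, h2⟩ := h
    refine foldMap_eq_of_one_le ?_ ?_
    · simpa [h1] using norm_le_pi_norm (gridVec (gridPath c π t) j) i
    · simpa [h2] using norm_le_pi_norm (gridLift c π t j) i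
  · unfold gridMap
    congr 1
    funext i
    exact (gridVec_gridPath hL c π t j i).resolve_right fun h' => h ⟨i, h'⟩

lemma exists_gridMap_small (N d : ℕ) {δ : ℝ} (hδ : 0 < δ) :
    ∃ M : ℕ, 2 ≤ M ∧ ∀ (c : Fin (N * d) → ZMod (2 * M)) (π : Equiv.Perm (Fin (N * d))) (s t : ℕ),
      dist (gridMap (gridPath c π s)) (gridMap (gridPath c π t)) < δ := by
  have hu := (isCompact_closedBall (0 : Fin d → ℝ) 1).uniformContinuousOn_of_continuous
    continuous_foldMap.continuousOn
  obtain ⟨ε, hε, hue⟩ := Metric.uniformContinuousOn_iff.1 hu δ hδ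
  obtain ⟨M, hM⟩ := exists_nat_gt (1 / ε)
  refine ⟨M + 2, by omega, fun c π s t => ?_⟩
  have : NeZero (2 * (M + 2)) := ⟨by omega⟩
  have hsmall : (2 : ℝ) / ((2 * (M + 2) : ℕ) : ℝ) < ε := by
    push_cast
    rw [div_lt_iff₀ (by positivity)]
    rw [div_lt_iff₀ hε] at hM
    nlinarith
  rw [dist_pi_lt_iff hδ]
  intro j
  rw [gridMap_gridPath (by omega), gridMap_gridPath (by omega)]
  refine hue _ (gridLift_mem c π s j) _ (gridLift_mem c π t j) ?_
  rw [dist_pi_lt_iff hε]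
  intro i
  rw [Real.dist_eq]
  have hp : (0 : ℝ) < 2 / ((2 * (M + 2) : ℕ) : ℝ) := by positivity
  refine lt_of_le_of_lt ?_ hsmall
  unfold gridLift
  rw [add_sub_add_left_eq_sub]
  split_ifs <;>
    simp only [sub_self, sub_zero, zero_sub, abs_neg, abs_zero, abs_of_nonneg hp.le] <;> linarith

end GridMap

section Evaluation

variable {N d L : ℕ}

/-- The product of the pull-backs of the orientation cochain along labelings `ℓ j` of the
factors `τ j`. -/
noncomputable def labelMonomial {S : Type*} (d N : ℕ) (τ : ℕ → Fin N) (ℓ : ℕ → S → ℕ) :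
    (ℕ → Fin N → S) → ℤ :=
  cupPow d (fun j x => orient d fun t => ℓ j (x t (τ j))) N

lemma labelMonomial_ne_zero {S : Type*} {τ : ℕ → Fin N} {ℓ : ℕ → S → ℕ} {x : ℕ → Fin N → S}
    (h : labelMonomial d N τ ℓ x ≠ 0) {j : ℕ} (hj : j < N) :
    orient d (fun t => ℓ j (x (d * j + t) (τ j))) ≠ 0  := by
  unfold labelMonomial cupPow at h
  exact Finset.prod_ne_zero_iff.1 h j (Finset.mem_range.2 hj)

lemma blockIndex_lt {j i : ℕ} (hj : j < N) (hi : i < d) : d * j + i < N * d := by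
  calc d * j + i < d * j + d := by omega
    _ = (j + 1) * d := by ring
    _ ≤ N * d := Nat.mul_le_mul_right d hj

lemma factor_of_ne_zero {τ : ℕ → Fin N} {ℓ : ℕ → SupSphere (d + 1) → ℕ}
    {c : Fin (N * d) → ZMod L} {π : Equiv.Perm (Fin (N * d))}
    (h : labelMonomial d N τ ℓ (fun t => gridMap (gridPath c π t)) ≠ 0)
    {j : ℕ} (hj : j < N) {i : ℕ} (hi : i < d) :
    (finProdFinEquiv.symm (π.symm ⟨d * j + i, blockIndex_lt hj hi⟩)).1 = τ j := by
  by_contra hne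
  refine labelMonomial_ne_zero h hj (orient_eq_zero_of_eq (s := i + 1) (t := i) hi hi.le
    (by omega) ?_)
  refine congrArg (ℓ j) (congrArg foldMap (funext fun s => ?_))
  unfold gridVec
  rw [← add_assoc, gridPath_succ_of_ne]
  intro h'
  apply hne
  rw [show (⟨d * j + i, blockIndex_lt hj hi⟩ : Fin (N * d)) = π (finProdFinEquiv (τ j, s)) from
    Fin.ext h'.symm]
  simp

lemma exists_of_ne_zero (hd : 1 ≤ d) {τ : ℕ → Fin N} {ℓ : ℕ → SupSphere (d + 1) → ℕ}
    {c : Fin (N * d) → ZMod L} {π : Equiv.Perm (Fin (N * d))}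
    (h : labelMonomial d N τ ℓ (fun t => gridMap (gridPath c π t)) ≠ 0) (f : Fin N) :
    ∃ j < N, τ j = f := by
  obtain ⟨b, hb⟩ : ∃ b, π.symm b = finProdFinEquiv (f, (⟨0, hd⟩ : Fin d)) :=
    ⟨π (finProdFinEquiv (f, (⟨0, hd⟩ : Fin d))), by simp⟩
  obtain ⟨⟨j, i⟩, rfl⟩ := finProdFinEquiv.surjective b
  refine ⟨j, j.2, ?_⟩
  rw [← factor_of_ne_zero h j.2 i.2]
  have : (⟨d * j + i, blockIndex_lt j.2 i.2⟩ : Fin (N * d)) = finProdFinEquiv (j, i) :=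
    Fin.ext (by simp [finProdFinEquiv, add_comm])
  rw [this, hb]; simp

/-- A monomial in which some factor does not occur integrates to zero. -/
lemma gridInt_labelMonomial_eq_zero [NeZero L] (hd : 1 ≤ d) {τ : ℕ → Fin N}
    (ℓ : ℕ → SupSphere (d + 1) → ℕ) {f : Fin N} (hf : ∀ j < N, τ j ≠ f) :
    gridInt (fun x : ℕ → Fin (N * d) → ZMod L =>
      labelMonomial d N τ ℓ (fun t => gridMap (x t))) = 0 := by
  refine Finset.sum_eq_zero fun c _ => Finset.sum_eq_zero fun π _ => ?_
  by_cases h : labelMonomial d N τ ℓ (fun t => gridMap (gridPath c π t)) = 0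
  · simp only [h, mul_zero]
  · obtain ⟨j, hj, hj'⟩ := exists_of_ne_zero hd h f
    exact absurd hj' (hf j hj)

/-- The permutation of the coordinates induced by a permutation of the factors. -/
def blockPerm (d : ℕ) (τ : Equiv.Perm (Fin N)) : Equiv.Perm (Fin (N * d)) :=
  finProdFinEquiv.permCongr (Equiv.prodCongrLeft fun _ : Fin d => τ.symm)

lemma blockPerm_apply (τ : Equiv.Perm (Fin N)) (j : Fin N) (i : Fin d) :
    blockPerm d τ (finProdFinEquiv (τ j, i)) = finProdFinEquiv (j, i) := by
  simp [blockPerm, Equiv.permCongr_apply]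

lemma sign_blockPerm (τ : Equiv.Perm (Fin N)) :
    Equiv.Perm.sign (blockPerm d τ) = Equiv.Perm.sign τ ^ d := by
  rw [blockPerm, Equiv.Perm.sign_permCongr, Equiv.Perm.sign_prodCongrLeft]
  simp

lemma finProdFinEquiv_val (j : Fin N) (i : Fin d) :
    (finProdFinEquiv (j, i) : ℕ) = d * j + i := by
  simp [finProdFinEquiv, add_comm]

lemma strictMono_labels_eq {l : ℕ → ℕ} {d : ℕ} (hl : ∀ t < d, l t < l (t + 1))
    (hd : l d ≤ d) : ∀ t ≤ d, l t = t := by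
  have h1 : ∀ t ≤ d, t ≤ l t := fun t => by
    induction t with
    | zero => intro _; exact Nat.zero_le _
    | succ t ih => intro h; have := ih (by omega); have := hl t (by omega); omega
  have h2 : ∀ s ≤ d, l (d - s) ≤ d - s := fun s => by
    induction s with
    | zero => intro _; simpa using hd
    | succ s ih =>
      intro h
      have h3 := ih (by omega)
      have h4 := hl (d - (s + 1)) (by omega)
      rw [show d - (s + 1) + 1 = d - s by omega] at h4
      omega
  intro t ht
  have := h2 (d - t) (by omega)
  rw [show d - (d - t) = t by omega] at this
  exact le_antisymm this (h1 t ht)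

/-- The only simplices contributing to the degree are the ones at the centre. -/
lemma eq_of_labelMonomial_ne_zero {M : ℕ} (hM : 2 ≤ M) {τ : Equiv.Perm (Fin N)} {τ' : ℕ → Fin N}
    (hτ : ∀ j : Fin N, τ' j = τ j) {c : Fin (N * d) → ZMod (2 * M)}
    {π : Equiv.Perm (Fin (N * d))}
    (h : labelMonomial d N τ' (fun _ (v : SupSphere (d + 1)) => negLabel (v : Fin (d + 1) → ℝ))
      (fun t => gridMap (gridPath c π t)) ≠ 0) :
    c = (fun _ => ((M - 1 : ℕ) : ZMod (2 * M))) ∧ π = blockPerm d τ := by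
  have : NeZero (2 * M) := ⟨by omega⟩
  suffices key : ∀ (j : Fin N) (i : Fin d), π (finProdFinEquiv (τ j, i)) = finProdFinEquiv (j, i) ∧
      c (finProdFinEquiv (τ j, i)) = ((M - 1 : ℕ) : ZMod (2 * M)) by
    constructor
    · funext a
      obtain ⟨⟨j, i⟩, rfl⟩ := finProdFinEquiv.surjective a
      simpa using (key (τ.symm j) i).2
    · ext a
      obtain ⟨⟨j, i⟩, rfl⟩ := finProdFinEquiv.surjective a
      have := blockPerm_apply τ (τ.symm j) i
      rw [Equiv.apply_symm_apply] at this
      rw [this]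
      simpa using congrArg Fin.val (key (τ.symm j) i).1
  intro j
  have hj := labelMonomial_ne_zero h j.2
  simp only [hτ] at hj
  set v : ℕ → Fin d → ℝ := fun t => gridVec (gridPath c π (d * j + t)) (τ j) with hv
  have hlab : ∀ t, negLabel (gridMap (gridPath c π (d * j + t)) (τ j) : Fin (d + 1) → ℝ) =
      if ‖v t‖ ≤ 1 / 2 then negLabel (v t) + 1 else 0 := fun t => negLabel_foldMap _
  simp only [hlab] at hj
  have hnorm : ∀ t ≤ d, ‖v t‖ ≤ 1 / 2 := fun t ht => by
    by_contra hn
    exact hj (orient_eq_zero_of_label_zero ht (if_neg hn))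
  have hlift : ∀ t ≤ d, v t = gridLift c π (d * j + t) (τ j) := fun t ht => by
    funext i
    refine (gridVec_gridPath (by omega) c π (d * j + t) (τ j) i).resolve_right fun h' => ?_
    have h1 := norm_le_pi_norm (v t) i
    have h2 := hnorm t ht
    rw [show v t i = -1 from h'.1] at h1
    norm_num at h1
    linarith
  have hpos : (0 : ℝ) < 2 / ((2 * M : ℕ) : ℝ) := by positivity
  have hmono : ∀ t < d, v t ≤ v (t + 1) := fun t ht i => by
    rw [hlift t ht.le, hlift (t + 1) ht]
    unfold gridLift
    split_ifs <;> linarith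
  have hstrict : ∀ t < d, negLabel (v t) < negLabel (v (t + 1)) := fun t ht => by
    refine lt_of_le_of_ne (negLabel_mono (hmono t ht)) fun heq => ?_
    refine hj (orient_eq_zero_of_eq (s := t) (t := t + 1) ht.le ht (by omega) ?_)
    rw [if_pos (hnorm t ht.le), if_pos (hnorm (t + 1) ht), heq]
  have heq : ∀ t ≤ d, negLabel (v t) = t := strictMono_labels_eq hstrict (negLabel_le _)
  intro i
  have hneg : v i i < 0 := neg_of_negLabel_eq (heq i i.2.le)
  have hnn : 0 ≤ v (i + 1) i :=
    nonneg_of_lt_negLabel (by rw [heq (i + 1) i.2]; omega)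
  have hπ : (π (finProdFinEquiv (τ j, i)) : ℕ) = d * j + i := by
    by_contra hne
    have : v (i + 1) i = v i i := by
      simp only [hv, gridVec]
      rw [← add_assoc, gridPath_succ_of_ne _ _ hne]
    linarith
  refine ⟨Fin.ext (by rw [hπ, finProdFinEquiv_val]), ?_⟩
  rw [hlift i i.2.le] at hneg
  rw [hlift (i + 1) i.2] at hnn
  unfold gridLift at hneg hnn
  rw [if_neg (by omega)] at hneg
  rw [if_pos (by omega)] at hnn
  have hMr : (0 : ℝ) < ((2 * M : ℕ) : ℝ) := by positivity
  unfold gridVec at hneg hnn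
  have e1 : ((c (finProdFinEquiv (τ j, i))).val : ℝ) < M := by
    rw [add_zero, sub_neg, div_lt_one hMr] at hneg
    push_cast at hneg; linarith
  have e2 : (M : ℝ) ≤ (c (finProdFinEquiv (τ j, i))).val + 1 := by
    have : 0 ≤ (2 * ((c (finProdFinEquiv (τ j, i))).val : ℝ) + 2) / ((2 * M : ℕ) : ℝ) - 1 := by
      rw [add_div]; linarith
    rw [sub_nonneg, one_le_div hMr] at this
    push_cast at this; linarith
  have e3 : (c (finProdFinEquiv (τ j, i))).val = M - 1 := by
    have h1 : (c (finProdFinEquiv (τ j, i))).val < M := by exact_mod_cast e1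
    have h2 : M ≤ (c (finProdFinEquiv (τ j, i))).val + 1 := by exact_mod_cast e2
    omega
  rw [← e3, ZMod.natCast_zmod_val]

lemma labelMonomial_center {M : ℕ} (hM : 2 ≤ M) {τ : Equiv.Perm (Fin N)} {τ' : ℕ → Fin N}
    (hτ : ∀ j : Fin N, τ' j = τ j) :
    labelMonomial d N τ' (fun _ (v : SupSphere (d + 1)) => negLabel (v : Fin (d + 1) → ℝ))
      (fun t => gridMap (gridPath (fun _ => ((M - 1 : ℕ) : ZMod (2 * M))) (blockPerm d τ) t)) = 1 := by
  have : NeZero (2 * M) := ⟨by omega⟩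
  have hMr : (2 : ℝ) ≤ M := by exact_mod_cast hM
  unfold labelMonomial cupPow
  refine Finset.prod_eq_one fun j hj => orient_eq_one fun t ht => ?_
  rw [Finset.mem_range] at hj
  have hτj := hτ ⟨j, hj⟩
  simp only at hτj
  rw [hτj]
  have hv : ∀ i : Fin d, gridVec (gridPath (fun _ => ((M - 1 : ℕ) : ZMod (2 * M)))
      (blockPerm d τ) (d * j + t)) (τ ⟨j, hj⟩) i = if (i : ℕ) < t then 0 else -1 / (M : ℝ) := by
    intro i
    unfold gridVec gridPath
    rw [blockPerm_apply, finProdFinEquiv_val]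
    simp only [Nat.add_lt_add_iff_left]
    split_ifs with h
    · have : ((M - 1 : ℕ) : ZMod (2 * M)) + 1 = (M : ℕ) := by
        rw [← Nat.cast_add_one, Nat.sub_add_cancel (by omega)]
      rw [this, ZMod.val_natCast_of_lt (by omega)]
      push_cast
      field_simp
      ring
    · rw [add_zero, ZMod.val_natCast_of_lt (by omega), Nat.cast_sub (by omega)]
      push_cast
      field_simp
      ring
  have hvf := funext hv
  unfold gridMap
  simp only [negLabel_foldMap, hvf]
  rw [if_pos]
  · congr 1
    apply le_antisymm
    · rcases ht.eq_or_lt with rfl | ht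
      · exact negLabel_le _
      · refine negLabel_le_of_neg (j := ⟨t, ht⟩) ?_
        simp only [lt_irrefl, if_false]
        apply div_neg_of_neg_of_pos <;> linarith
    · rcases negLabel_mem (fun i : Fin d => if (i : ℕ) < t then (0 : ℝ) else -1 / M) with
        h | ⟨i, hi, hneg⟩
      · rw [h]; exact ht
      · by_contra! hlt
        rw [← hi] at hlt
        rw [if_pos hlt] at hneg
        exact lt_irrefl _ hneg
  · rw [pi_norm_le_iff_of_nonneg (by norm_num)]
    intro i
    split_ifs
    · simp
    · rw [Real.norm_eq_abs, abs_div, abs_neg, abs_one, abs_of_pos (by linarith)]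
      exact one_div_le_one_div_of_le (by norm_num) hMr

/-- The degree of the grid map composed with a permutation of the factors. -/
lemma gridInt_labelMonomial_perm {M : ℕ} [NeZero (2 * M)] (hM : 2 ≤ M) {τ : Equiv.Perm (Fin N)}
    {τ' : ℕ → Fin N} (hτ : ∀ j : Fin N, τ' j = τ j) :
    gridInt (fun x : ℕ → Fin (N * d) → ZMod (2 * M) =>
      labelMonomial d N τ' (fun _ (v : SupSphere (d + 1)) => negLabel (v : Fin (d + 1) → ℝ)) (fun t => gridMap (x t))) =
      (Equiv.Perm.sign τ : ℤ) ^ d := by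
  unfold gridInt
  rw [Finset.sum_eq_single (fun _ => ((M - 1 : ℕ) : ZMod (2 * M))),
    Finset.sum_eq_single (blockPerm d τ)]
  · simp only [labelMonomial_center hM hτ, sign_blockPerm]
    simp
  · intro π _ hπ
    by_contra h
    exact hπ (eq_of_labelMonomial_ne_zero hM hτ (right_ne_zero_of_mul h)).2
  · simp
  · intro c _ hc
    refine Finset.sum_eq_zero fun π _ => ?_
    by_contra h
    exact hc (eq_of_labelMonomial_ne_zero hM hτ (right_ne_zero_of_mul h)).1
  · simp

end Evaluation

/-! ### Homotopies and cohomologous cochains -/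

section Homotopies


lemma exists_pos_forall_le {α : Type*} (F : Finset α) {r : α → ℝ} (hr : ∀ a, 0 < r a) :
    ∃ ε > 0, ∀ a ∈ F, ε ≤ r a := by
  classical
  induction F using Finset.induction_on with
  | empty => exact ⟨1, one_pos, by simp⟩
  | insert a s _ ih =>
    obtain ⟨ε, hε, h⟩ := ih
    refine ⟨min ε (r a), lt_min hε (hr a), fun b hb => ?_⟩
    rcases Finset.mem_insert.1 hb with rfl | hb
    · exact min_le_right _ _
    · exact (min_le_left _ _).trans (h b hb)

variable {T : Type*} {d : ℕ}

/-- The pull-back of the orientation cochain along a vector-valued function. -/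
noncomputable def vecPull (d : ℕ) (f : T → Fin (d + 1) → ℝ) (x : ℕ → T) : ℤ :=
  orient d fun t => negLabel (f (x t))

lemma isCochain_vecPull (f : T → Fin (d + 1) → ℝ) : IsCochain d (vecPull d f) := fun x y h =>
  isCochain_orient d _ _ fun t ht => by rw [h t ht]

lemma cobd_vecPull_eq_zero {f : T → Fin (d + 1) → ℝ} {x : ℕ → T} {c : Fin (d + 1) → ℝ}
    (h : ∀ t, ‖f (x t) - c‖ < ‖c‖) : cobd d (vecPull d f) x = 0 := by
  obtain ⟨q, hq, hc⟩ := exists_negLabel_ne c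
  exact cobd_orient_eq_zero (l := fun t => negLabel (f (x t))) (fun t => negLabel_le _) hq
    fun t => hc _ (h t)

/-- The pull-backs along `f` and `g` are cohomologous on the set of streams `P`. -/
def VecCohomologous (d : ℕ) (f g : T → Fin (d + 2) → ℝ) (P : Set (ℕ → T)) : Prop :=
  ∃ η : (ℕ → T) → ℤ, IsCochain d η ∧
    ∀ x ∈ P, vecPull (d + 1) f x - vecPull (d + 1) g x = cobd d η x

lemma VecCohomologous.refl (f : T → Fin (d + 2) → ℝ) (P : Set (ℕ → T)) :
    VecCohomologous d f f P :=
  ⟨0, fun _ _ _ => rfl, fun x _ => by simp [cobd]⟩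

lemma VecCohomologous.trans {f g h : T → Fin (d + 2) → ℝ} {P : Set (ℕ → T)}
    (h₁ : VecCohomologous d f g P) (h₂ : VecCohomologous d g h P) : VecCohomologous d f h P := by
  obtain ⟨η, hη, h₁⟩ := h₁
  obtain ⟨θ, hθ, h₂⟩ := h₂
  refine ⟨η + θ, fun x y hxy => by simp only [Pi.add_apply, hη x y hxy, hθ x y hxy],
    fun x hx => ?_⟩
  have : cobd d (η + θ) x = cobd d η x + cobd d θ x := by
    simp only [cobd, Pi.add_apply, mul_add, Finset.sum_add_distrib]
  rw [this, ← h₁ x hx, ← h₂ x hx]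
  ring

lemma VecCohomologous.of_close {f g : T → Fin (d + 2) → ℝ} {P : Set (ℕ → T)}
    (h : ∀ x ∈ P, ∃ c : Fin (d + 2) → ℝ, ∀ t, ‖f (x t) - c‖ < ‖c‖ ∧ ‖g (x t) - c‖ < ‖c‖) :
    VecCohomologous d f g P := by
  refine ⟨prismCochain d (orient (d + 1)) (fun y => negLabel (g y)) (fun y => negLabel (f y)),
    isCochain_prismCochain (isCochain_orient _) _ _, fun x hx => ?_⟩
  rw [cobd_prismCochain (isCochain_orient _)]
  · rfl
  · intro i
    obtain ⟨c, hc⟩ := h x hx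
    obtain ⟨q, hq, hc'⟩ := exists_negLabel_ne c
    refine cobd_orient_eq_zero (fun t => ?_) hq fun t => ?_
    · unfold prismStream; split_ifs <;> exact negLabel_le _
    · unfold prismStream; split_ifs
      exacts [hc' _ (hc _).2, hc' _ (hc _).1]

/-- The streams in `V` of diameter less than `ε`. -/
def smallStreams [PseudoMetricSpace T] (V : Set T) (ε : ℝ) : Set (ℕ → T) :=
  {x | (∀ t, x t ∈ V) ∧ ∀ s t, dist (x s) (x t) < ε}

variable [MetricSpace T]

lemma exists_homotopy_modulus {A : Set T} {f g : C(T, {v : Fin d → ℝ // v ≠ 0})}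
    {h : A → I → Fin d → ℝ} (hc : Continuous fun q : A × I => h q.1 q.2) (h0 : ∀ a t, h a t ≠ 0)
    (a : A) :
    ∃ ρ > 0, ∃ δ > 0, ∃ κ > 0, (∀ t, 4 * ρ ≤ ‖h a t‖) ∧
      (∀ b : A, dist (b : T) a < δ → ∀ t, ‖h b t - h a t‖ < ρ) ∧
      (∀ x : T, dist x a < δ → ‖(f x : Fin d → ℝ) - f a‖ < ρ ∧ ‖(g x : Fin d → ℝ) - g a‖ < ρ) ∧
      ∀ s t : I, dist s t < κ → ‖h a s - h a t‖ < ρ := by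
  have hca : Continuous (h a) := hc.comp (by fun_prop : Continuous fun t : I => (a, t))
  obtain ⟨t₀, -, ht₀⟩ := isCompact_univ.exists_isMinOn ⟨(0 : I), trivial⟩ hca.norm.continuousOn
  set ρ := ‖h a t₀‖ / 4 with hρ
  have hρ0 : 0 < ρ := div_pos (norm_pos_iff.2 (h0 a t₀)) (by norm_num)
  let Φ : C(A, C(I, Fin d → ℝ)) := ContinuousMap.curry ⟨_, hc⟩
  obtain ⟨δ₁, hδ₁, H₁⟩ := Metric.continuous_iff.1 Φ.continuous a ρ hρ0
  obtain ⟨δ₂, hδ₂, H₂⟩ := Metric.continuous_iff.1 f.continuous a ρ hρ0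
  obtain ⟨δ₃, hδ₃, H₃⟩ := Metric.continuous_iff.1 g.continuous a ρ hρ0
  obtain ⟨κ, hκ, H₄⟩ := Metric.uniformContinuous_iff.1
    (CompactSpace.uniformContinuous_of_continuous hca) ρ hρ0
  refine ⟨ρ, hρ0, min δ₁ (min δ₂ δ₃), lt_min hδ₁ (lt_min hδ₂ hδ₃), κ, hκ, fun t => ?_,
    fun b hb t => ?_, fun x hx => ⟨?_, ?_⟩, fun s t hst => ?_⟩
  · have : ‖h a t₀‖ ≤ ‖h a t‖ := ht₀ (Set.mem_univ t)
    rw [hρ]; linarith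
  · have := H₁ b (hb.trans_le (min_le_left _ _))
    rw [← dist_eq_norm]
    exact (ContinuousMap.dist_apply_le_dist (f := Φ b) (g := Φ a) t).trans_lt this
  · rw [← dist_eq_norm]
    exact H₂ x (hx.trans_le ((min_le_right _ _).trans (min_le_left _ _)))
  · rw [← dist_eq_norm]
    exact H₃ x (hx.trans_le ((min_le_right _ _).trans (min_le_right _ _)))
  · rw [← dist_eq_norm]
    exact H₄ hst

/-- Locally homotopic maps have cohomologous pull-backs, uniformly for a finite cover. -/
theorem exists_vecCohomologous_of_cover [CompactSpace T] {N : ℕ} {A : Fin N → Set T}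
    (hA : ⋃ j, A j = Set.univ) {f g : Fin N → C(T, {v : Fin (d + 2) → ℝ // v ≠ 0})}
    (H : ∀ j, ((f j).restrict (A j)).Homotopic ((g j).restrict (A j))) :
    ∃ ε > 0, ∃ V : Fin N → Set T, (∀ x ∈ smallStreams Set.univ ε, ∃ j, x ∈ smallStreams (V j) ε) ∧
      ∀ j, VecCohomologous d (fun x => f j x) (fun x => g j x) (smallStreams (V j) ε) := by
  classical
  have Hh : ∀ j, ∃ h : A j → I → Fin (d + 2) → ℝ, (Continuous fun q : A j × I => h q.1 q.2) ∧
      (∀ a t, h a t ≠ 0) ∧ (∀ a, h a 0 = f j a) ∧ ∀ a, h a 1 = g j a := fun j => by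
    obtain ⟨F⟩ := H j
    refine ⟨fun a t => F (t, a), ?_, fun a t => (F (t, a)).2, fun a => ?_, fun a => ?_⟩
    · exact continuous_subtype_val.comp (F.continuous.comp continuous_swap)
    · simp
    · simp
  choose h hc h0 hf hg using Hh
  have hmem : ∀ a : T, ∃ j, a ∈ A j := fun a => by
    have : a ∈ ⋃ j, A j := hA ▸ Set.mem_univ a
    simpa using this
  choose ι hι using hmem
  have hloc := fun a : T => exists_homotopy_modulus (f := f (ι a)) (g := g (ι a)) (hc (ι a))
    (h0 (ι a)) ⟨a, hι a⟩
  choose ρ hρ δ hδ κ hκ hρn hδh hδf hκh using hloc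
  obtain ⟨F, hF⟩ := CompactSpace.elim_nhds_subcover (fun a => Metric.ball a (δ a / 6))
    fun a => Metric.ball_mem_nhds a (by have := hδ a; positivity)
  obtain ⟨ε, hε, hεF⟩ := exists_pos_forall_le F (r := fun a => δ a / 6)
    fun a => by have := hδ a; positivity
  obtain ⟨κ₀, hκ₀, hκF⟩ := exists_pos_forall_le F hκ
  obtain ⟨K, hK⟩ := exists_nat_gt (1 / κ₀)
  have hK0 : (0 : ℝ) < K := lt_trans (by positivity) hK
  refine ⟨ε, hε, fun j => {x | ∃ a ∈ F, ι a = j ∧ dist x a < 2 * (δ a / 6)}, ?_, fun j => ?_⟩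
  · intro x hx
    have : x 0 ∈ ⋃ a ∈ F, Metric.ball a (δ a / 6) := hF ▸ Set.mem_univ _
    simp only [Set.mem_iUnion, Metric.mem_ball] at this
    obtain ⟨a, ha, hxa⟩ := this
    refine ⟨ι a, fun t => ⟨a, ha, rfl, ?_⟩, hx.2⟩
    have h1 := hx.2 t 0
    have h2 := dist_triangle (x t) (x 0) a
    have h3 := hεF a ha
    linarith
  · set V : Set T := {x | ∃ a ∈ F, ι a = j ∧ dist x a < 2 * (δ a / 6)} with hV
    have hα : ∀ x : T, ∃ a, x ∈ V → a ∈ F ∧ ι a = j ∧ dist x a < 2 * (δ a / 6) := fun x => by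
      by_cases hx : x ∈ V
      · obtain ⟨a, ha⟩ := hx; exact ⟨a, fun _ => ha⟩
      · exact ⟨x, fun h => absurd h hx⟩
    choose α hα using hα
    let G : ℝ → T → Fin (d + 2) → ℝ := fun s x =>
      if hx : α x ∈ A j then h j ⟨α x, hx⟩ (Set.projIcc 0 1 zero_le_one s) else 0
    have key : ∀ x ∈ smallStreams V ε, ∃ a ∈ F, ∃ ha : ι a = j, ∀ t, ∃ hm : α (x t) ∈ A j,
        (∀ s, ‖h j ⟨α (x t), hm⟩ s - h j ⟨a, ha ▸ hι a⟩ s‖ < ρ a) ∧ dist (x t) a < δ a := by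
      intro x hx
      have hfin : (Set.range fun t => α (x t)).Finite :=
        F.finite_toSet.subset (by rintro _ ⟨t, rfl⟩; exact (hα _ (hx.1 t)).1)
      obtain ⟨a, ⟨t₀, rfl⟩, hmax⟩ := Set.exists_max_image _ δ hfin ⟨_, 0, rfl⟩
      obtain ⟨haF, haj, had⟩ := hα _ (hx.1 t₀)
      refine ⟨α (x t₀), haF, haj, fun t => ?_⟩
      obtain ⟨htF, htj, htd⟩ := hα _ (hx.1 t)
      have hle : δ (α (x t)) ≤ δ (α (x t₀)) := hmax _ ⟨t, rfl⟩
      have h1 := hx.2 t t₀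
      have h2 := hεF _ haF
      have h3 := dist_triangle (x t) (x t₀) (α (x t₀))
      have h4 := dist_triangle (α (x t)) (x t) (α (x t₀))
      rw [dist_comm (α (x t)) (x t)] at h4
      have h5 := hδ (α (x t₀))
      refine ⟨htj ▸ hι _, ?_, by linarith⟩
      generalize α (x t₀) = a at *
      subst haj
      exact fun s => hδh a ⟨α (x t), _⟩ (by change dist (α (x t)) a < δ a; linarith) s
    have hstep : ∀ s s' : ℝ, dist s s' < κ₀ → VecCohomologous d (G s) (G s') (smallStreams V ε) := by
      intro s s' hs
      refine VecCohomologous.of_close fun x hx => ?_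
      obtain ⟨a, haF, haj, hx⟩ := key x hx
      refine ⟨h j ⟨a, haj ▸ hι a⟩ (Set.projIcc 0 1 zero_le_one s), fun t => ?_⟩
      obtain ⟨hm, hxs, -⟩ := hx t
      have h1 := hxs (Set.projIcc 0 1 zero_le_one s)
      have h2 := hxs (Set.projIcc 0 1 zero_le_one s')
      subst haj
      have h3 := hρn a (Set.projIcc 0 1 zero_le_one s)
      have h4 := hκh a (Set.projIcc 0 1 zero_le_one s') (Set.projIcc 0 1 zero_le_one s) (by
        rw [dist_comm]
        refine lt_of_le_of_lt ?_ (hs.trans_le (hκF a haF))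
        rw [Subtype.dist_eq, Real.dist_eq, Real.dist_eq]
        exact Set.abs_projIcc_sub_projIcc zero_le_one)
      have h5 := hρ a
      simp only [G, dif_pos hm]
      refine ⟨by linarith, ?_⟩
      have h6 := norm_sub_le_norm_sub_add_norm_sub (h (ι a) ⟨α (x t), hm⟩
        (Set.projIcc 0 1 zero_le_one s')) (h (ι a) ⟨a, hι a⟩ (Set.projIcc 0 1 zero_le_one s'))
        (h (ι a) ⟨a, hι a⟩ (Set.projIcc 0 1 zero_le_one s))
      linarith
    have hchain : ∀ k : ℕ, VecCohomologous d (G 0) (G (k / K)) (smallStreams V ε) := by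
      intro k
      induction k with
      | zero => simpa using VecCohomologous.refl _ _
      | succ k ih =>
        refine ih.trans (hstep _ _ ?_)
        have : ((k + 1 : ℕ) : ℝ) / K = k / K + 1 / K := by push_cast; ring
        rw [this, Real.dist_eq, sub_add_cancel_left, abs_neg, abs_of_pos (by positivity)]
        rw [div_lt_iff₀ hκ₀] at hK
        rw [div_lt_iff₀ hK0]
        linarith
    have hstart : VecCohomologous d (fun x => f j x) (G 0) (smallStreams V ε) := by
      refine VecCohomologous.of_close fun x hx => ?_
      obtain ⟨a, haF, haj, hx⟩ := key x hx
      refine ⟨h j ⟨a, haj ▸ hι a⟩ 0, fun t => ?_⟩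
      obtain ⟨hm, hxs, hxd⟩ := hx t
      have h1 := hxs 0
      subst haj
      have h3 := hρn a 0
      have h4 := (hδf a (x t) hxd).1
      have h5 := hρ a
      have h6 := hf (ι a) ⟨a, hι a⟩
      simp only [G, dif_pos hm, Set.projIcc_left]
      rw [← h6] at h4
      exact ⟨by linarith, by change ‖h _ _ 0 - _‖ < _; linarith⟩
    have hend : VecCohomologous d (G 1) (fun x => g j x) (smallStreams V ε) := by
      refine VecCohomologous.of_close fun x hx => ?_
      obtain ⟨a, haF, haj, hx⟩ := key x hx
      refine ⟨h j ⟨a, haj ▸ hι a⟩ 1, fun t => ?_⟩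
      obtain ⟨hm, hxs, hxd⟩ := hx t
      have h1 := hxs 1
      subst haj
      have h3 := hρn a 1
      have h4 := (hδf a (x t) hxd).2
      have h5 := hρ a
      have h6 := hg (ι a) ⟨a, hι a⟩
      simp only [G, dif_pos hm, Set.projIcc_right]
      rw [← h6] at h4
      exact ⟨by change ‖h _ _ 1 - _‖ < _; linarith, by linarith⟩
    have h1 := hchain K
    rw [div_self hK0.ne'] at h1
    exact (hstart.trans h1).trans hend

end Homotopies

lemma exists_norm_sub_lt {T : Type*} {d : ℕ} [MetricSpace T] [CompactSpace T]
    (f : C(T, {v : Fin d → ℝ // v ≠ 0})) :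
    ∃ δ > 0, ∀ x y, dist x y < δ → ‖(f x : Fin d → ℝ) - f y‖ < ‖(f y : Fin d → ℝ)‖ := by
  rcases isEmpty_or_nonempty T with hT | ⟨⟨z⟩⟩
  · exact ⟨1, one_pos, fun x => hT.elim x⟩
  have hc : Continuous fun x => (f x : Fin d → ℝ) := continuous_subtype_val.comp f.continuous
  obtain ⟨x₀, -, hx₀⟩ := isCompact_univ.exists_isMinOn ⟨z, trivial⟩ hc.norm.continuousOn
  obtain ⟨δ, hδ, H⟩ := Metric.uniformContinuous_iff.1
    (CompactSpace.uniformContinuous_of_continuous hc) _ (norm_pos_iff.2 (f x₀).2)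
  refine ⟨δ, hδ, fun x y hxy => lt_of_lt_of_le ?_ (hx₀ (Set.mem_univ y))⟩
  rw [← dist_eq_norm]
  exact H hxy

lemma cobd_sub {T : Type*} (p : ℕ) (a b : (ℕ → T) → ℤ) (x : ℕ → T) :
    cobd p (fun x => a x - b x) x = cobd p a x - cobd p b x := by
  simp only [cobd, mul_sub, Finset.sum_sub_distrib]

lemma IsCochain.sub {T : Type*} {p : ℕ} {a b : (ℕ → T) → ℤ} (ha : IsCochain p a)
    (hb : IsCochain p b) : IsCochain p fun x => a x - b x := fun x y h => by
  simp only [ha x y h, hb x y h]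

lemma gridInt_cobd_of_eq {D n L : ℕ} [NeZero L] (hD : D = n + 1)
    {η : (ℕ → Fin D → ZMod L) → ℤ} (hη : IsCochain n η) : gridInt (cobd n η) = 0 := by
  subst hD
  exact gridInt_cobd hη

/-- If a product of spheres is covered by as many sets as there are factors, and the maps `f j`
and `g j` are homotopic on the `j`-th set, then the product of the differences of the pull-backs
of the fundamental class integrates to zero. -/
theorem exists_gridInt_prod_eq_zero {N d : ℕ} (hN : 0 < N)
    {A : Fin N → Set (Fin N → SupSphere (d + 2))} (hA : ⋃ j, A j = Set.univ)
    {f g : Fin N → C(Fin N → SupSphere (d + 2), {v : Fin (d + 2) → ℝ // v ≠ 0})}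
    (H : ∀ j, ((f j).restrict (A j)).Homotopic ((g j).restrict (A j))) :
    ∃ M : ℕ, 2 ≤ M ∧ ∀ [NeZero (2 * M)],
      gridInt (fun x : ℕ → Fin (N * (d + 1)) → ZMod (2 * M) => ∏ j : Fin N,
        (vecPull (d + 1) (fun y => (f j y : Fin (d + 2) → ℝ))
            (fun t => gridMap (x ((d + 1) * j + t)))
          - vecPull (d + 1) (fun y => (g j y : Fin (d + 2) → ℝ))
            (fun t => gridMap (x ((d + 1) * j + t))))) = 0 := by
  classical
  obtain ⟨ε, hε, V, hV, Hc⟩ := exists_vecCohomologous_of_cover hA H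
  choose η hη Hη using Hc
  choose δf hδf Hf using fun j => exists_norm_sub_lt (f j)
  choose δg hδg Hg using fun j => exists_norm_sub_lt (g j)
  obtain ⟨ε₁, hε₁, H₁⟩ := exists_pos_forall_le Finset.univ hδf
  obtain ⟨ε₂, hε₂, H₂⟩ := exists_pos_forall_le Finset.univ hδg
  obtain ⟨M, hM, HM⟩ := exists_gridMap_small N (d + 1) (lt_min hε (lt_min hε₁ hε₂))
  refine ⟨M, hM, fun {_} => ?_⟩
  set P : Set (ℕ → Fin N → SupSphere (d + 2)) :=
    smallStreams Set.univ (min ε (min ε₁ ε₂)) with hP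
  let v : ℕ → (ℕ → Fin N → SupSphere (d + 2)) → ℤ := fun j x => if h : j < N then
    vecPull (d + 1) (fun y => (f ⟨j, h⟩ y : Fin (d + 2) → ℝ)) x -
      vecPull (d + 1) (fun y => (g ⟨j, h⟩ y : Fin (d + 2) → ℝ)) x else 0
  let θ : ℕ → (ℕ → Fin N → SupSphere (d + 2)) → ℤ := fun j => if h : j < N then η ⟨j, h⟩ else 0
  have hv : ∀ j, IsCochain (d + 1) (v j) := fun j => by
    by_cases h : j < N
    · simp only [v, dif_pos h]
      exact (isCochain_vecPull _).sub (isCochain_vecPull _)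
    · simp only [v, dif_neg h]
      exact fun _ _ _ => rfl
  have hθ : ∀ j, IsCochain d (θ j) := fun j => by
    by_cases h : j < N
    · simp only [θ, dif_pos h]
      exact hη _
    · simp only [θ, dif_neg h]
      exact fun _ _ _ => rfl
  have hPφ : ∀ x ∈ P, ∀ φ : ℕ → ℕ, x ∘ φ ∈ P := fun x hx φ =>
    ⟨fun t => hx.1 _, fun s t => hx.2 _ _⟩
  have hv0 : ∀ j, ∀ x ∈ P, cobd (d + 1) (v j) x = 0 := fun j x hx => by
    by_cases h : j < N
    · have hvj : v j = fun x => vecPull (d + 1) (fun y => (f ⟨j, h⟩ y : Fin (d + 2) → ℝ)) x -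
          vecPull (d + 1) (fun y => (g ⟨j, h⟩ y : Fin (d + 2) → ℝ)) x := by
        funext x; exact dif_pos h
      rw [hvj, cobd_sub, cobd_vecPull_eq_zero (c := (f ⟨j, h⟩ (x 0) : Fin (d + 2) → ℝ)) fun t => ?_,
        cobd_vecPull_eq_zero (c := (g ⟨j, h⟩ (x 0) : Fin (d + 2) → ℝ)) fun t => ?_, sub_zero]
      · exact Hg _ _ _ ((hx.2 t 0).trans_le (((min_le_right _ _).trans (min_le_right _ _)).trans
          (H₂ _ (Finset.mem_univ _))))
      · exact Hf _ _ _ ((hx.2 t 0).trans_le (((min_le_right _ _).trans (min_le_left _ _)).trans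
          (H₁ _ (Finset.mem_univ _))))
    · have hvj : v j = fun x => 0 := by
        funext x; exact dif_neg h
      rw [hvj]
      simp [cobd]
  obtain ⟨n, rfl⟩ : ∃ n, N = n + 1 := ⟨N - 1, by omega⟩
  obtain ⟨ζ, hζ, Hζ⟩ := cupPow_cohomologous hv hθ hPφ hv0 n
  have hzero : ∀ x ∈ P, cupPow (d + 1) (fun j x => v j x - cobd d (θ j) x) (n + 1) x = 0 := by
    intro x hx
    obtain ⟨j, hj⟩ := hV x ⟨hx.1, fun s t => (hx.2 s t).trans_le (min_le_left _ _)⟩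
    refine Finset.prod_eq_zero (Finset.mem_range.2 j.2) ?_
    simp only [v, θ, dif_pos j.2]
    rw [← Hη j _ ⟨fun t => hj.1 _, fun s t => hj.2 _ _⟩, sub_self]
  have hζ' : IsCochain ((d + 1) * (n + 1) - 1)
      (fun x : ℕ → Fin ((n + 1) * (d + 1)) → ZMod (2 * M) => ζ fun t => gridMap (x t)) :=
    fun x y h => hζ _ _ fun t ht => by rw [h t ht]
  have hD : (n + 1) * (d + 1) = (d + 1) * (n + 1) - 1 + 1 := by
    rw [Nat.sub_add_cancel (by positivity : 0 < (d + 1) * (n + 1)), mul_comm]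
  have hgrid := gridInt_cobd_of_eq hD hζ'
  unfold gridInt at hgrid ⊢
  rw [← neg_eq_zero, ← hgrid, ← Finset.sum_neg_distrib]
  refine Finset.sum_congr rfl fun c _ => ?_
  rw [← Finset.sum_neg_distrib]
  refine Finset.sum_congr rfl fun π _ => ?_
  have hx : (fun t => gridMap (gridPath c π t)) ∈ P := ⟨fun t => trivial, fun s t => HM c π s t⟩
  have h1 := Hζ _ hx
  rw [hzero _ hx] at h1
  have h2 : cupPow (d + 1) v (n + 1) (fun t => gridMap (gridPath c π t)) = ∏ j : Fin (n + 1),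
        (vecPull (d + 1) (fun y => (f j y : Fin (d + 2) → ℝ))
            (fun t => gridMap (gridPath c π ((d + 1) * j + t)))
          - vecPull (d + 1) (fun y => (g j y : Fin (d + 2) → ℝ))
            (fun t => gridMap (gridPath c π ((d + 1) * j + t)))) := by
    unfold cupPow
    rw [Finset.prod_range]
    refine Finset.prod_congr rfl fun j _ => ?_
    simp only [v, dif_pos j.2]
  beta_reduce
  rw [← h2, ← mul_neg, neg_eq_of_add_eq_zero_right h1.symm]
  rfl

/-- The `j`-th coordinate of a product of spheres, as a nowhere vanishing map. -/
def sphereProj {N n : ℕ} (j : Fin N) : C(Fin N → SupSphere n, {v : Fin n → ℝ // v ≠ 0}) where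
  toFun y := ⟨y j, (y j).ne_zero⟩
  continuous_toFun := by fun_prop

lemma gridInt_finset_sum {ι : Type*} {D L : ℕ} [NeZero L] (s : Finset ι) (c : ι → ℤ)
    (φ : ι → (ℕ → Fin D → ZMod L) → ℤ) :
    gridInt (fun x => ∑ i ∈ s, c i * φ i x) = ∑ i ∈ s, c i * gridInt (φ i) := by
  simp only [gridInt, Finset.mul_sum]
  refine (Finset.sum_congr rfl fun c _ => Finset.sum_comm).trans (Finset.sum_comm.trans ?_)
  refine Finset.sum_congr rfl fun i _ => Finset.sum_congr rfl fun c _ =>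
    Finset.sum_congr rfl fun π _ => by ring

lemma prod_sub_eq_sum_piecewise {ι : Type*} [Fintype ι] [DecidableEq ι] (F G : ι → ℤ) :
    ∏ j, (F j - G j) = ∑ S : Finset ι, (-1) ^ S.card * ∏ j, if j ∈ S then G j else F j := by
  have := Finset.prod_add (fun j => -G j) F Finset.univ
  simp only [neg_add_eq_sub, Finset.powerset_univ] at this
  rw [this]
  refine Finset.sum_congr rfl fun S _ => ?_
  rw [Finset.prod_neg, mul_assoc, Finset.prod_ite]
  congr 2
  · exact Finset.prod_congr (by ext; simp) fun _ _ => rfl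
  · exact Finset.prod_congr (by ext; simp) fun _ _ => rfl

/-- The product of `N` spheres cannot be covered by `N` sets on the `j`-th of which the `j`-th
coordinate is homotopic to a constant map. -/
theorem not_homotopic_const_of_cover {N d : ℕ} (hN : 0 < N)
    {A : Fin N → Set (Fin N → SupSphere (d + 2))} (hA : ⋃ j, A j = Set.univ)
    {g : Fin N → C(Fin N → SupSphere (d + 2), {v : Fin (d + 2) → ℝ // v ≠ 0})}
    (hg : ∀ j, ∃ c : Fin (d + 2) → ℝ, ∀ y, (g j y : Fin (d + 2) → ℝ) = c) :
    ¬ ∀ j, ((sphereProj j).restrict (A j)).Homotopic ((g j).restrict (A j)) := by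
  intro H
  obtain ⟨M, hM, HM⟩ := exists_gridInt_prod_eq_zero hN hA H
  have : NeZero (2 * M) := ⟨by omega⟩
  have h1 := gridInt_labelMonomial_perm (N := N) (d := d + 1) hM (τ := 1)
    (τ' := fun j => if h : j < N then ⟨j, h⟩ else ⟨0, hN⟩) fun j => by simp
  rw [Equiv.Perm.sign_one] at h1
  refine one_ne_zero (α := ℤ) ?_
  calc (1 : ℤ) = ((1 : ℤˣ) : ℤ) ^ (d + 1) := by simp
    _ = _ := h1.symm
    _ = _ := ?_
    _ = 0 := HM
  congr 1
  funext x
  unfold labelMonomial cupPow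
  rw [Finset.prod_range]
  refine Finset.prod_congr rfl fun j _ => ?_
  obtain ⟨c, hc⟩ := hg j
  have h0 : vecPull (d + 1) (fun y => (g j y : Fin (d + 2) → ℝ))
      (fun t => gridMap (x ((d + 1) * j + t))) = 0 :=
    orient_eq_zero_of_eq (Nat.zero_le _) (Nat.le_add_left 1 d) zero_ne_one (by simp only [hc])
  rw [h0, sub_zero]
  simp only [dif_pos j.2]
  rfl

/-- For even-dimensional spheres, the product of `N` spheres cannot be covered by `N` sets, on two
of which the coordinates `a` and `b` are homotopic, and on each of the remaining ones of which
the corresponding coordinate is homotopic to a function of the `b`-th coordinate. -/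
theorem not_homotopic_swap_of_cover {N d : ℕ} (hd : Even (d + 1)) {a b : Fin N} (hab : a ≠ b)
    {A : Fin N → Set (Fin N → SupSphere (d + 2))} (hA : ⋃ j, A j = Set.univ)
    {g : Fin N → C(Fin N → SupSphere (d + 2), {v : Fin (d + 2) → ℝ // v ≠ 0})}
    (hga : g a = sphereProj b) (hgb : g b = sphereProj a)
    (hg : ∀ j, j ≠ a → j ≠ b →
      ∃ ψ : SupSphere (d + 2) → Fin (d + 2) → ℝ, ∀ y, (g j y : Fin (d + 2) → ℝ) = ψ (y b)) :
    ¬ ∀ j, ((sphereProj j).restrict (A j)).Homotopic ((g j).restrict (A j)) := by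
  classical
  intro H
  obtain ⟨M, hM, HM⟩ := exists_gridInt_prod_eq_zero (Fin.pos a) hA H
  have : NeZero (2 * M) := ⟨by omega⟩
  have hψ : ∃ ψ : Fin N → SupSphere (d + 2) → Fin (d + 2) → ℝ,
      (∀ v, ψ a v = v) ∧ (∀ v, ψ b v = v) ∧ ∀ j y, (g j y : Fin (d + 2) → ℝ) =
        ψ j (y (if j = b then a else b)) := by
    choose! ψ hψ using hg
    refine ⟨fun j => if j = a ∨ j = b then fun v => v else ψ j, by simp, by simp, fun j y => ?_⟩
    by_cases ha : j = a
    · subst ha; simp [hab, hga, sphereProj]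
    by_cases hb : j = b
    · subst hb; simp [hgb, sphereProj]
    simp [ha, hb, hψ]
  obtain ⟨ψ, hψa, hψb, hψ⟩ := hψ
  let τ : Finset (Fin N) → ℕ → Fin N := fun S j => if h : j < N then
    (if ⟨j, h⟩ ∈ S then if ⟨j, h⟩ = b then a else b else ⟨j, h⟩) else a
  let ℓ : Finset (Fin N) → ℕ → SupSphere (d + 2) → ℕ := fun S j v => if h : j < N then
    (if ⟨j, h⟩ ∈ S then negLabel (ψ ⟨j, h⟩ v) else negLabel (v : Fin (d + 2) → ℝ))
    else negLabel (v : Fin (d + 2) → ℝ)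
  let φ : Finset (Fin N) → (ℕ → Fin (N * (d + 1)) → ZMod (2 * M)) → ℤ := fun S x =>
    labelMonomial (d + 1) N (τ S) (ℓ S) fun t => gridMap (x t)
  have hsum : ∑ S : Finset (Fin N), (-1) ^ S.card * gridInt (φ S) = 0 := by
    rw [← gridInt_finset_sum, ← HM]
    congr 1
    funext x
    rw [prod_sub_eq_sum_piecewise]
    refine Finset.sum_congr rfl fun S _ => ?_
    congr 1
    simp only [φ, labelMonomial, cupPow]
    rw [Finset.prod_range]
    refine Finset.prod_congr rfl fun j _ => ?_
    by_cases hj : j ∈ S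
    · simp only [τ, ℓ, dif_pos j.2, Fin.eta, if_pos hj, vecPull, hψ]
    · simp only [τ, ℓ, dif_pos j.2, Fin.eta, if_neg hj, vecPull]
      rfl
  have hvanish : ∀ S : Finset (Fin N), S ≠ ∅ → S ≠ {a, b} → gridInt (φ S) = 0 := by
    intro S hS hS'
    suffices h : ∃ f : Fin N, ∀ j < N, τ S j ≠ f by
      obtain ⟨f, hf⟩ := h
      exact gridInt_labelMonomial_eq_zero (Nat.le_add_left 1 d) _ hf
    suffices h : ∃ f : Fin N, ∀ j : Fin N, (if j ∈ S then if j = b then a else b else j) ≠ f by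
      obtain ⟨f, hf⟩ := h
      exact ⟨f, fun j hj => by simpa only [τ, dif_pos hj] using hf ⟨j, hj⟩⟩
    by_cases hj : ∃ j ∈ S, j ≠ a ∧ j ≠ b
    · obtain ⟨j, hjS, hja, hjb⟩ := hj
      refine ⟨j, fun i => ?_⟩
      split_ifs with h1 h2
      exacts [hja.symm, hjb.symm, fun h => h1 (h ▸ hjS)]
    push Not at hj
    by_cases ha : a ∈ S
    · have hb : b ∉ S := fun hb => hS' (by
        ext j
        simp only [Finset.mem_insert, Finset.mem_singleton]
        exact ⟨fun h => or_iff_not_imp_left.2 (hj j h), by rintro (rfl | rfl) <;> assumption⟩)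
      refine ⟨a, fun i => ?_⟩
      split_ifs with h1 h2
      exacts [absurd (h2 ▸ h1) hb, hab.symm, fun h => h1 (h ▸ ha)]
    · have hb : b ∈ S := by
        obtain ⟨j, hjS⟩ := Finset.nonempty_iff_ne_empty.2 hS
        exact hj j hjS (fun h => ha (h ▸ hjS)) ▸ hjS
      refine ⟨b, fun i => ?_⟩
      split_ifs with h1 h2
      exacts [hab, absurd (hj i h1 fun h => ha (h ▸ h1)) h2, fun h => h1 (h ▸ hb)]
  have hempty : gridInt (φ ∅) = 1 := by
    have hℓ : ℓ ∅ = fun _ (v : SupSphere (d + 2)) => negLabel (v : Fin (d + 2) → ℝ) := by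
      funext j v
      simp [ℓ]
    have h1 := gridInt_labelMonomial_perm (N := N) (d := d + 1) hM (τ := 1) (τ' := τ ∅) fun j => by
      simp [τ]
    simp only [φ, hℓ]
    rw [h1, Equiv.Perm.sign_one]
    simp
  have hpair : gridInt (φ {a, b}) = 1 := by
    have hℓ : ℓ {a, b} = fun _ (v : SupSphere (d + 2)) => negLabel (v : Fin (d + 2) → ℝ) := by
      funext j v
      simp only [ℓ]
      split_ifs with h1 h2
      · rcases Finset.mem_insert.1 h2 with h | h
        · rw [h, hψa]
        · rw [Finset.mem_singleton.1 h, hψb]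
      · rfl
      · rfl
    have h1 := gridInt_labelMonomial_perm (N := N) (d := d + 1) hM (τ := Equiv.swap a b)
      (τ' := τ {a, b}) fun j => by
        simp only [τ, dif_pos j.2, Fin.eta, Finset.mem_insert, Finset.mem_singleton,
          Equiv.swap_apply_def]
        split_ifs <;> simp_all
    simp only [φ, hℓ]
    rw [h1, Equiv.Perm.sign_swap hab]
    simpa using hd.neg_one_pow
  have hne : (∅ : Finset (Fin N)) ≠ {a, b} := (Finset.insert_ne_empty _ _).symm
  rw [← Finset.sum_subset (Finset.subset_univ {∅, {a, b}}) fun S _ hS => by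
    simp only [Finset.mem_insert, Finset.mem_singleton, not_or] at hS
    rw [hvanish S hS.1 hS.2, mul_zero], Finset.sum_pair hne, hempty, hpair,
    Finset.card_pair hab] at hsum
  norm_num at hsum

/-! ### Euclidean neighbourhood retracts assembled from clopen pieces -/

section ENR

lemma IsENR.of_finiteDimensional {A Z : Type*} [TopologicalSpace A] [NormedAddCommGroup Z]
    [NormedSpace ℝ Z] [FiniteDimensional ℝ Z] {e : A → Z} (he : IsEmbedding e) {U : Set Z}
    (hU : IsOpen U) (heU : ∀ a, e a ∈ U) {r : U → A} (hr : Continuous r)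
    (hre : ∀ a, r ⟨e a, heU a⟩ = a) : IsENR A := by
  let φ : Z ≃L[ℝ] (Fin (Module.finrank ℝ Z) → ℝ) := (Module.finBasis ℝ Z).equivFunL
  refine ⟨_, φ ∘ e, φ.toHomeomorph.isEmbedding.comp he, φ.symm ⁻¹' U,
    hU.preimage φ.symm.continuous, ?_, fun z => r ⟨φ.symm z, z.2⟩, by fun_prop, fun a h => ?_⟩
  · rintro _ ⟨a, rfl⟩
    simpa using heU a
  · simpa using hre a

/-- A space that embeds in a finite-dimensional space, and that is a finite disjoint union of
clopen pieces each of which is a neighbourhood retract, is an ENR. -/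
lemma IsENR.of_clopen_pieces {A Z κ : Type*} [TopologicalSpace A] [NormedAddCommGroup Z]
    [NormedSpace ℝ Z] [FiniteDimensional ℝ Z] [Finite κ] {e : A → Z} (he : IsEmbedding e)
    {idx : A → κ} (hidx : IsLocallyConstant idx) {U : κ → Set Z} (hU : ∀ q, IsOpen (U q))
    (heU : ∀ a, e a ∈ U (idx a)) {ρ : ∀ q, U q → A} (hρ : ∀ q, Continuous (ρ q))
    (hρe : ∀ a, ρ (idx a) ⟨e a, heU a⟩ = a) : IsENR A := by
  classical
  have := Fintype.ofFinite κ
  rcases isEmpty_or_nonempty A with hA | ⟨⟨a₀⟩⟩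
  · exact IsENR.of_finiteDimensional he isOpen_empty (fun a => hA.elim a) (r := fun z => z.2.elim)
      (continuous_of_const fun z => z.2.elim) fun a => hA.elim a
  let r : κ → Z → A := fun q => Function.extend Subtype.val (ρ q) fun _ => a₀
  have hrρ : ∀ q (z : U q), r q z = ρ q z := fun q z =>
    Subtype.val_injective.extend_apply (ρ q) _ z
  have hr : ∀ q, ContinuousOn (r q) (U q) := fun q => by
    rw [continuousOn_iff_continuous_domRestrict]
    exact (hρ q).congr fun z => (hrρ q z).symm
  have hre : ∀ a, r (idx a) (e a) = a := fun a => (hrρ _ ⟨e a, heU a⟩).trans (hρe a)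
  let W : κ → Set (κ → ℝ) := fun q => {w | 1 / 2 < w q ∧ ∀ q', q' ≠ q → w q' < 1 / 2}
  have hW : ∀ q, IsOpen (W q) := fun q => by
    simp only [W, Set.ofPred_and, Set.ofPred_forall]
    exact (isOpen_lt continuous_const (continuous_apply q)).inter
      (isOpen_iInter_of_finite fun q' => isOpen_iInter_of_finite fun _ =>
        isOpen_lt (continuous_apply q') continuous_const)
  have hWd : ∀ {q q' w}, w ∈ W q → w ∈ W q' → q = q' := fun {q q' w} h h' => by
    by_contra hne
    linarith [h.1, h'.2 q hne]
  let E : A → Z × (κ → ℝ) := fun a => (e a, Pi.single (idx a) 1)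
  have hE : IsEmbedding E := by
    refine IsEmbedding.of_comp ?_ continuous_fst (he : IsEmbedding (Prod.fst ∘ E))
    refine he.continuous.prodMk ?_
    exact (hidx.comp fun q => (Pi.single q (1 : ℝ) : κ → ℝ)).continuous
  have hEW : ∀ a, (Pi.single (idx a) 1 : κ → ℝ) ∈ W (idx a) := fun a => by
    refine ⟨by simp; norm_num, fun q' h => ?_⟩
    rw [Pi.single_eq_of_ne h]
    norm_num
  have hex : ∀ z : (⋃ q, U q ×ˢ W q : Set (Z × (κ → ℝ))), ∃ q, z.1 ∈ U q ×ˢ W q := fun z => by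
    exact mem_iUnion.1 z.2
  choose τ hτ using hex
  refine IsENR.of_finiteDimensional hE (U := ⋃ q, U q ×ˢ W q)
    (isOpen_iUnion fun q => (hU q).prod (hW q)) (fun a => ?_) (r := fun z => r (τ z) z.1.1) ?_ ?_
  · exact mem_iUnion.2 ⟨idx a, heU a, hEW a⟩
  · rw [continuous_iff_continuousAt]
    intro z
    have hopen : ∀ᶠ y : (⋃ q, U q ×ˢ W q : Set (Z × (κ → ℝ))) in 𝓝 z, y.1 ∈ U (τ z) ×ˢ W (τ z) :=
      continuous_subtype_val.continuousAt.eventually_mem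
        (((hU _).prod (hW _)).mem_nhds (hτ z))
    have h1 : ContinuousAt (fun y : (⋃ q, U q ×ˢ W q : Set (Z × (κ → ℝ))) => r (τ z) y.1.1) z :=
      ContinuousAt.comp (f := fun y : (⋃ q, U q ×ˢ W q : Set (Z × (κ → ℝ))) => y.1.1)
        ((hr (τ z)).continuousAt ((hU _).mem_nhds (hτ z).1)) (by fun_prop)
    refine h1.congr (hopen.mono fun y hy => ?_)
    rw [hWd hy.2 (hτ y).2]
  · intro a
    have : τ ⟨E a, mem_iUnion.2 ⟨idx a, heU a, hEW a⟩⟩ = idx a := hWd (hτ _).2 (hEW a)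
    rw [this]
    exact hre a

end ENR

/-! ### Level sets of real-valued functions on a finite set -/

section Levels

variable {Q : Type*}

/-- The pairs of points at which a function takes the same value. -/
def levelRel (h : Q → ℝ) : Set (Q × Q) := {q | h q.1 = h q.2}

lemma mem_levelRel {h : Q → ℝ} {a b : Q} : (a, b) ∈ levelRel h ↔ h a = h b := Iff.rfl

lemma exists_comp_eq {f g : Q → ℝ} (h : levelRel f ⊆ levelRel g) : ∃ φ : ℝ → ℝ, g = φ ∘ f :=
  ⟨Function.extend f g 0, funext fun a =>
    (Function.FactorsThrough.extend_apply (f := f) (g := g)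
      (fun a b (hab : f a = f b) => h (mem_levelRel.2 hab : (a, b) ∈ levelRel f)) 0 a).symm⟩

variable [Fintype Q]

open Classical in
/-- The number of values of a function on a finite set. -/
noncomputable def levelCount (h : Q → ℝ) : ℕ := (Finset.univ.image h).card

lemma levelCount_eq_of_levelRel_eq {f g : Q → ℝ} (h : levelRel f = levelRel g) :
    levelCount f = levelCount g := by
  classical
  obtain ⟨φ, hφ⟩ := exists_comp_eq h.subset
  obtain ⟨ψ, hψ⟩ := exists_comp_eq h.symm.subset
  unfold levelCount
  refine le_antisymm ?_ ?_
  · nth_rw 1 [hψ]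
    rw [← Finset.image_image]
    exact Finset.card_image_le
  · nth_rw 1 [hφ]
    rw [← Finset.image_image]
    exact Finset.card_image_le

lemma levelRel_eq_of_subset {f g : Q → ℝ} (h : levelRel f ⊆ levelRel g)
    (hc : levelCount f = levelCount g) : levelRel f = levelRel g := by
  classical
  obtain ⟨φ, rfl⟩ := exists_comp_eq h
  refine h.antisymm fun q hq => ?_
  unfold levelCount at hc
  rw [← Finset.image_image] at hc
  exact Finset.injOn_of_card_image_eq hc.symm (by simp) (by simp) hq

lemma isLocallyConstant_levelRel {S : Type*} [TopologicalSpace S] {h : S → Q → ℝ}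
    (hh : Continuous h) {c : ℕ} (hc : ∀ s, levelCount (h s) = c) :
    IsLocallyConstant fun s => levelRel (h s) := by
  rw [IsLocallyConstant.iff_eventually_eq]
  intro s
  have : ∀ᶠ s' in 𝓝 s, ∀ a b : Q, h s a ≠ h s b → h s' a ≠ h s' b := by
    simp only [Filter.eventually_all]
    intro a b hab
    exact (isOpen_ne_fun ((continuous_apply a).comp hh) ((continuous_apply b).comp hh)).mem_nhds hab
  refine this.mono fun s' hs' => levelRel_eq_of_subset (fun q hq => ?_) ((hc _).trans (hc _).symm)
  by_contra hq'
  exact hs' _ _ hq' hq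

lemma levelCount_pos [Nonempty Q] (h : Q → ℝ) : 0 < levelCount h := by
  classical
  exact Finset.card_pos.2 (Finset.univ_nonempty.image h)

lemma levelCount_le (h : Q → ℝ) : levelCount h ≤ Fintype.card Q := by
  classical
  exact Finset.card_image_le

lemma one_lt_levelCount {h : Q → ℝ} {a b : Q} (hab : h a ≠ h b) : 1 < levelCount h := by
  classical
  exact Finset.one_lt_card.2 ⟨h a, by simp, h b, by simp, hab⟩

open Classical in
/-- The least distance between distinct values of a function, or `1` if that is smaller. -/
noncomputable def levelGap [Nonempty Q] (h : Q → ℝ) : ℝ :=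
  Finset.univ.inf' Finset.univ_nonempty fun q : Q × Q =>
    if q ∈ levelRel h then 1 else |h q.1 - h q.2|

lemma levelGap_pos [Nonempty Q] (h : Q → ℝ) : 0 < levelGap h := by
  unfold levelGap
  rw [Finset.lt_inf'_iff]
  intro q _
  split_ifs with hq
  · exact one_pos
  · exact abs_pos.2 (sub_ne_zero.2 hq)

lemma levelGap_le [Nonempty Q] {h : Q → ℝ} {a b : Q} (hab : h a ≠ h b) :
    levelGap h ≤ |h a - h b| := by
  refine (Finset.inf'_le _ (Finset.mem_univ (a, b))).trans ?_
  rw [if_neg (show (a, b) ∉ levelRel h from hab)]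

lemma continuous_levelGap [Nonempty Q] {S : Type*} [TopologicalSpace S] {h : S → Q → ℝ}
    (hh : Continuous h) {c : ℕ} (hc : ∀ s, levelCount (h s) = c) :
    Continuous fun s => levelGap (h s) := by
  classical
  have hR := isLocallyConstant_levelRel hh hc
  rw [IsLocallyConstant.iff_eventually_eq] at hR
  unfold levelGap
  refine Continuous.finset_inf'_apply _ fun q _ => continuous_iff_continuousAt.2 fun s => ?_
  have h1 : ContinuousAt (fun s' => if q ∈ levelRel (h s) then 1 else |h s' q.1 - h s' q.2|) s := by
    split_ifs
    · exact continuousAt_const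
    · fun_prop
  refine h1.congr ((hR s).mono fun s' hs' => ?_)
  simp only [hs']

open Classical in
/-- The average of `h` over the class of `a` in the relation `R`. -/
noncomputable def classAvg (R : Set (Q × Q)) (h : Q → ℝ) (a : Q) : ℝ :=
  (∑ b with (a, b) ∈ R, h b) / (Finset.univ.filter fun b => (a, b) ∈ R).card

lemma classAvg_levelRel_self (h : Q → ℝ) (a : Q) : classAvg (levelRel h) h a = h a := by
  classical
  have h0 : (Finset.univ.filter fun b => (a, b) ∈ levelRel h).card ≠ 0 :=
    Finset.card_ne_zero.2 ⟨a, by simp [mem_levelRel]⟩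
  unfold classAvg
  rw [Finset.sum_congr rfl fun b hb => (mem_levelRel.1 (Finset.mem_filter.1 hb).2).symm,
    Finset.sum_const, nsmul_eq_mul]
  field_simp

lemma classAvg_congr {g : Q → ℝ} (h : Q → ℝ) {a b : Q} (hab : g a = g b) :
    classAvg (levelRel g) h a = classAvg (levelRel g) h b := by
  simp only [classAvg, mem_levelRel, hab]

lemma continuous_classAvg (R : Set (Q × Q)) (a : Q) : Continuous fun h : Q → ℝ => classAvg R h a := by
  unfold classAvg
  fun_prop

end Levels

/-! ### Strata of pairs of configurations in the same fibre -/

section Strata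

variable {k m n : ℕ}

/-- The index set of the points of two configurations sharing their first `m` points. -/
abbrev FibreIdx (m n : ℕ) : Type := Fin m ⊕ Fin n ⊕ Fin n

/-- The points of a pair of configurations. -/
def fibrePts (w : confSet k (m + n) × confSet k (m + n)) : FibreIdx m n → Fin k → ℝ :=
  Sum.elim (fun i => w.1.1 (Fin.castAdd n i))
    (Sum.elim (fun j => w.1.1 (Fin.natAdd m j)) fun j => w.2.1 (Fin.natAdd m j))

/-- The first configuration of a pair. -/
def leftPts (x : FibreIdx m n → Fin k → ℝ) : Fin (m + n) → Fin k → ℝ :=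
  Fin.append (fun i => x (Sum.inl i)) fun j => x (Sum.inr (Sum.inl j))

/-- The second configuration of a pair. -/
def rightPts (x : FibreIdx m n → Fin k → ℝ) : Fin (m + n) → Fin k → ℝ :=
  Fin.append (fun i => x (Sum.inl i)) fun j => x (Sum.inr (Sum.inr j))

lemma leftPts_fibrePts (w : confSet k (m + n) × confSet k (m + n)) :
    leftPts (fibrePts w) = w.1.1 :=
  Fin.append_castAdd_natAdd (f := w.1.1)

lemma rightPts_fibrePts {w : confSet k (m + n) × confSet k (m + n)}
    (h : FNmap k m n w.1 = FNmap k m n w.2) : rightPts (fibrePts w) = w.2.1 := by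
  have h' : ∀ i, w.1.1 (Fin.castAdd n i) = w.2.1 (Fin.castAdd n i) := fun i =>
    congrFun (congrArg Subtype.val h) i
  refine Eq.trans ?_ (Fin.append_castAdd_natAdd (f := w.2.1))
  exact congrArg₂ Fin.append (funext h') rfl

lemma fibrePts_mk {x : FibreIdx m n → Fin k → ℝ} (hl : leftPts x ∈ confSet k (m + n))
    (hr : rightPts x ∈ confSet k (m + n)) : fibrePts (⟨leftPts x, hl⟩, ⟨rightPts x, hr⟩) = x := by
  funext a
  rcases a with i | j | j <;> simp [fibrePts, leftPts, rightPts]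

lemma FNmap_mk_eq {x : FibreIdx m n → Fin k → ℝ} (hl : leftPts x ∈ confSet k (m + n))
    (hr : rightPts x ∈ confSet k (m + n)) :
    FNmap k m n ⟨leftPts x, hl⟩ = FNmap k m n ⟨rightPts x, hr⟩ := by
  apply Subtype.ext
  funext i
  simp [FNmap, leftPts, rightPts]

lemma continuous_fibrePts :
    Continuous (fibrePts : confSet k (m + n) × confSet k (m + n) → FibreIdx m n → Fin k → ℝ) := by
  refine continuous_pi fun a => ?_
  rcases a with i | j | j
  · exact (continuous_apply (Fin.castAdd n i)).comp (continuous_subtype_val.comp continuous_fst)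
  · exact (continuous_apply (Fin.natAdd m j)).comp (continuous_subtype_val.comp continuous_fst)
  · exact (continuous_apply (Fin.natAdd m j)).comp (continuous_subtype_val.comp continuous_snd)

lemma continuous_append {S V : Type*} [TopologicalSpace S] [TopologicalSpace V]
    {f : S → Fin m → V} {g : S → Fin n → V} (hf : Continuous f) (hg : Continuous g) :
    Continuous fun s => Fin.append (f s) (g s) := by
  refine continuous_pi fun i => ?_
  refine Fin.addCases (fun i => ?_) (fun j => ?_) i
  · simp only [Fin.append_left]
    exact (continuous_apply i).comp hf
  · simp only [Fin.append_right]
    exact (continuous_apply j).comp hg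

lemma continuous_leftPts :
    Continuous (leftPts : (FibreIdx m n → Fin k → ℝ) → Fin (m + n) → Fin k → ℝ) :=
  continuous_append (by fun_prop) (by fun_prop)

lemma continuous_rightPts :
    Continuous (rightPts : (FibreIdx m n → Fin k → ℝ) → Fin (m + n) → Fin k → ℝ) :=
  continuous_append (by fun_prop) (by fun_prop)

lemma isOpen_confSet (k m : ℕ) : IsOpen (confSet k m) := by
  have : confSet k m = ⋂ (i) (j) (_ : i ≠ j), {z | z i ≠ z j} := by
    ext z
    simp only [confSet, mem_iInter]
    exact ⟨fun h i j hij h' => hij (h h'), fun h i j h' => by_contra fun hij => h i j hij h'⟩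
  rw [this]
  exact isOpen_iInter_of_finite fun i => isOpen_iInter_of_finite fun j =>
    isOpen_iInter_of_finite fun _ => isOpen_ne_fun (continuous_apply i) (continuous_apply j)

variable (e : (FibreIdx m n → Fin k → ℝ) → Fin k → ℝ)

/-- The heights of points in the direction `e`. -/
def heights (x : FibreIdx m n → Fin k → ℝ) (a : FibreIdx m n) : ℝ := e x ⬝ᵥ x a

/-- The pairs of configurations in the same fibre whose points have exactly `c` distinct heights
in the direction `e`. -/
def stratum (c : ℕ) : Set (confSet k (m + n) × confSet k (m + n)) :=
  {w | FNmap k m n w.1 = FNmap k m n w.2 ∧ levelCount (heights e (fibrePts w)) = c}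

variable {e}

lemma continuous_heights (he : Continuous e) : Continuous (heights e) := by
  unfold heights
  exact continuous_pi fun a => he.dotProduct (continuous_apply a)

lemma isEmbedding_fibrePts_stratum (c : ℕ) :
    IsEmbedding fun w : stratum e c => fibrePts w.1 := by
  have h : IsEmbedding fun w : stratum e c => (leftPts (fibrePts w.1), rightPts (fibrePts w.1)) := by
    have : (fun w : stratum e c => (leftPts (fibrePts w.1), rightPts (fibrePts w.1))) =
        fun w : stratum e c => (w.1.1.1, w.1.2.1) := by
      funext w
      rw [leftPts_fibrePts, rightPts_fibrePts w.2.1]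
    rw [this]
    exact (IsEmbedding.subtypeVal.prodMap IsEmbedding.subtypeVal).comp IsEmbedding.subtypeVal
  exact IsEmbedding.of_comp (continuous_fibrePts.comp continuous_subtype_val)
    (continuous_leftPts.prodMk continuous_rightPts) h

/-- Moving points in the direction `e` to the average height of their class. -/
noncomputable def levelling (e : (FibreIdx m n → Fin k → ℝ) → Fin k → ℝ)
    (R : Set (FibreIdx m n × FibreIdx m n)) (x : FibreIdx m n → Fin k → ℝ) :
    FibreIdx m n → Fin k → ℝ := fun a =>
  x a + ((classAvg R (heights e x) a - heights e x a) / (e x ⬝ᵥ e x)) • e x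

lemma dotProduct_levelling {R : Set (FibreIdx m n × FibreIdx m n)} {x : FibreIdx m n → Fin k → ℝ}
    (hx : e x ≠ 0) (a : FibreIdx m n) : e x ⬝ᵥ levelling e R x a = classAvg R (heights e x) a := by
  have : e x ⬝ᵥ e x ≠ 0 := dotProduct_self_eq_zero.not.2 hx
  unfold levelling
  rw [dotProduct_add, dotProduct_smul, smul_eq_mul, div_mul_cancel₀ _ this]
  simp [heights]

lemma levelling_self (x : FibreIdx m n → Fin k → ℝ) :
    levelling e (levelRel (heights e x)) x = x := by
  funext a
  simp [levelling, classAvg_levelRel_self]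

/-- The strata are ENRs. -/
theorem isENR_stratum (he : Continuous e)
    (he0 : ∀ x, leftPts x ∈ confSet k (m + n) → rightPts x ∈ confSet k (m + n) → e x ≠ 0)
    (heμ : ∀ x (l : FibreIdx m n → ℝ), ∃ μ : ℝ, e (fun a => x a + l a • e x) = μ • e x) (c : ℕ) :
    IsENRSet (stratum e c) := by
  let U : Set (FibreIdx m n × FibreIdx m n) → Set (FibreIdx m n → Fin k → ℝ) := fun R =>
    {x | e x ≠ 0} ∩ {x | (∃ w ∈ stratum e c, levelRel (heights e (fibrePts w)) = R) ∧
      leftPts (levelling e R x) ∈ confSet k (m + n) ∧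
      rightPts (levelling e R x) ∈ confSet k (m + n) ∧
      ∀ a b, (a, b) ∉ R → classAvg R (heights e x) a ≠ classAvg R (heights e x) b}
  have hlev : ∀ R, ContinuousOn (levelling e R) {x | e x ≠ 0} := fun R => by
    refine continuousOn_pi.2 fun a => ?_
    unfold levelling
    have h1 : ContinuousOn e {x | e x ≠ 0} := he.continuousOn
    refine ContinuousOn.add (by fun_prop) (ContinuousOn.fun_smul (ContinuousOn.div₀ ?_ ?_ ?_) h1)
    · exact (((continuous_classAvg R a).comp (continuous_heights he)).sub
        ((continuous_apply a).comp (continuous_heights he))).continuousOn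
    · exact (he.dotProduct he).continuousOn
    · exact fun x hx => dotProduct_self_eq_zero.not.2 hx
  have hmem : ∀ R, ∀ x ∈ U R, ∃ (hl : leftPts (levelling e R x) ∈ confSet k (m + n))
      (hr : rightPts (levelling e R x) ∈ confSet k (m + n)),
      ((⟨leftPts (levelling e R x), hl⟩, ⟨rightPts (levelling e R x), hr⟩) :
        confSet k (m + n) × confSet k (m + n)) ∈ stratum e c := by
    rintro R x ⟨hx0, ⟨w, hw, rfl⟩, hl, hr, hx⟩
    refine ⟨hl, hr, FNmap_mk_eq hl hr, ?_⟩
    rw [fibrePts_mk]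
    rw [← hw.2]
    apply levelCount_eq_of_levelRel_eq
    obtain ⟨μ, hμ⟩ := heμ x fun a =>
      (classAvg (levelRel (heights e (fibrePts w))) (heights e x) a - heights e x a) /
        (e x ⬝ᵥ e x)
    change e (levelling e (levelRel (heights e (fibrePts w))) x) = μ • e x at hμ
    have hμ0 : μ ≠ 0 := by
      rintro rfl
      exact he0 _ hl hr (by rw [hμ, zero_smul])
    ext ⟨a, b⟩
    rw [mem_levelRel]
    simp only [heights, hμ, smul_dotProduct, dotProduct_levelling hx0, smul_eq_mul]
    rw [mul_right_inj' hμ0]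
    refine ⟨fun h => by_contra fun hab => hx a b hab h, fun h => classAvg_congr _ h⟩
  refine IsENR.of_clopen_pieces (isEmbedding_fibrePts_stratum c)
    (idx := fun w => levelRel (heights e (fibrePts w.1)))
    (isLocallyConstant_levelRel ((continuous_heights he).comp
      (continuous_fibrePts.comp continuous_subtype_val)) fun w => w.2.2)
    (U := U) (fun R => ?_) (fun w => ?_)
    (ρ := fun R x => ⟨_, (hmem R x x.2).choose_spec.choose_spec⟩) (fun R => ?_) fun w => ?_
  · by_cases hR : ∃ w ∈ stratum e c, levelRel (heights e (fibrePts w)) = R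
    · have hUR : U R = ({x | e x ≠ 0} ∩ levelling e R ⁻¹'
          (leftPts ⁻¹' confSet k (m + n) ∩ rightPts ⁻¹' confSet k (m + n))) ∩
          ⋂ (a) (b) (_ : (a, b) ∉ R),
            {x | classAvg R (heights e x) a ≠ classAvg R (heights e x) b} := by
        ext x
        simp only [U, hR, true_and, mem_inter_iff, mem_preimage, mem_iInter]
        exact ⟨fun h => ⟨⟨h.1, h.2.1, h.2.2.1⟩, h.2.2.2⟩, fun h => ⟨h.1.1, h.1.2.1, h.1.2.2, h.2⟩⟩
      rw [hUR]
      refine ((hlev R).isOpen_inter_preimage (isOpen_ne_fun he continuous_const)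
        (((isOpen_confSet _ _).preimage continuous_leftPts).inter
          ((isOpen_confSet _ _).preimage continuous_rightPts))).inter ?_
      exact isOpen_iInter_of_finite fun a => isOpen_iInter_of_finite fun b =>
        isOpen_iInter_of_finite fun _ => isOpen_ne_fun
          ((continuous_classAvg R a).comp (continuous_heights he))
          ((continuous_classAvg R b).comp (continuous_heights he))
    · have hUR : U R = ∅ := eq_empty_of_forall_notMem fun x hx => hR hx.2.1
      rw [hUR]
      exact isOpen_empty
  · have hl : leftPts (fibrePts w.1) ∈ confSet k (m + n) := by
      rw [leftPts_fibrePts]; exact w.1.1.2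
    have hr : rightPts (fibrePts w.1) ∈ confSet k (m + n) := by
      rw [rightPts_fibrePts w.2.1]; exact w.1.2.2
    refine ⟨he0 _ hl hr, ⟨w.1, w.2, rfl⟩, ?_, ?_, fun a b hab => ?_⟩
    · rwa [levelling_self]
    · rwa [levelling_self]
    · rw [classAvg_levelRel_self, classAvg_levelRel_self]
      exact hab
  · have h1 : Continuous fun x : U R => levelling e R x := 
      continuousOn_iff_continuous_domRestrict.1 ((hlev R).mono inter_subset_left)
    exact (((continuous_leftPts.comp h1).subtype_mk _).prodMk
      ((continuous_rightPts.comp h1).subtype_mk _)).subtype_mk _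
  · apply Subtype.ext
    refine Prod.ext (Subtype.ext ?_) (Subtype.ext ?_)
    · change leftPts (levelling e _ (fibrePts w.1)) = _
      rw [levelling_self, leftPts_fibrePts]
    · change rightPts (levelling e _ (fibrePts w.1)) = _
      rw [levelling_self, rightPts_fibrePts w.2.1]

end Strata

/-! ### Motion planners on the strata -/

section Planner

variable {k m n : ℕ}

/-- The displacement raising the `j`-th point by `ε * (j + 1)` in the direction `e` and bringing
it to the height `r + j` in the direction `f`. -/
noncomputable def raised (e f : Fin k → ℝ) (ε r : ℝ) (z : Fin n → Fin k → ℝ) (j : Fin n) :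
    Fin k → ℝ :=
  z j + ((ε * (j + 1) / (e ⬝ᵥ e)) • e + ((r + j - f ⬝ᵥ z j) / (f ⬝ᵥ f)) • f)

variable {e f : Fin k → ℝ} {o : Fin m → Fin k → ℝ} {z z' : Fin n → Fin k → ℝ} {δ r t : ℝ}

lemma dotProduct_raised (ε r : ℝ) (he : e ≠ 0) (hef : e ⬝ᵥ f = 0) (j : Fin n) (t : ℝ) :
    e ⬝ᵥ (z j + t • (raised e f ε r z j - z j)) = e ⬝ᵥ z j + t * (ε * (j + 1)) := by
  have : e ⬝ᵥ e ≠ 0 := dotProduct_self_eq_zero.not.2 he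
  simp only [raised, add_sub_cancel_left, dotProduct_add, dotProduct_smul, hef, smul_eq_mul]
  field_simp
  ring

lemma dotProduct_raised' (ε r : ℝ) (hf : f ≠ 0) (hef : e ⬝ᵥ f = 0) (j : Fin n) :
    f ⬝ᵥ raised e f ε r z j = r + j := by
  have : f ⬝ᵥ f ≠ 0 := dotProduct_self_eq_zero.not.2 hf
  rw [dotProduct_comm] at hef
  simp only [raised, dotProduct_add, dotProduct_smul, hef, smul_eq_mul]
  field_simp
  ring

lemma injective_append_raised (he : e ≠ 0) (hef : e ⬝ᵥ f = 0) (hδ : 0 < δ)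
    (hoz : ∀ i j, e ⬝ᵥ o i ≠ e ⬝ᵥ z j → δ ≤ |e ⬝ᵥ o i - e ⬝ᵥ z j|)
    (hzz : ∀ i j, e ⬝ᵥ z i ≠ e ⬝ᵥ z j → δ ≤ |e ⬝ᵥ z i - e ⬝ᵥ z j|)
    (hinj : Function.Injective (Fin.append o z)) (ht : t ∈ Icc (0 : ℝ) 1) :
    Function.Injective (Fin.append o fun j =>
      z j + t • (raised e f (δ / (n + 2)) r z j - z j)) := by
  rcases ht.1.eq_or_lt with rfl | ht0
  · simpa using hinj
  rw [Fin.append_injective_iff] at hinj ⊢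
  obtain ⟨ho, hz, hoz'⟩ := hinj
  have hn : (0 : ℝ) < n + 2 := by positivity
  have hε : 0 < δ / (n + 2) := by positivity
  have hεn : δ / (n + 2) * (n + 1) < δ := by
    rw [div_mul_eq_mul_div, div_lt_iff₀ hn]
    nlinarith
  have hbound : ∀ x : ℝ, |x| ≤ n + 1 → |t * (δ / (n + 2) * x)| < δ := fun x hx => by
    rw [abs_mul, abs_mul, abs_of_pos ht0, abs_of_pos hε]
    refine lt_of_le_of_lt ?_ hεn
    calc t * (δ / (n + 2) * |x|) ≤ 1 * (δ / (n + 2) * (n + 1)) := by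
          gcongr
          exact ht.2
      _ = _ := one_mul _
  have hj : ∀ j : Fin n, (j : ℝ) + 1 ≤ n := fun j => by exact_mod_cast j.2
  refine ⟨ho, fun i j hij => ?_, fun i j hij => ?_⟩
  · have h1 := congrArg (e ⬝ᵥ ·) hij
    simp only [dotProduct_raised _ _ he hef] at h1
    have h2 : e ⬝ᵥ z i - e ⬝ᵥ z j = t * (δ / (n + 2) * ((j : ℝ) - i)) := by linear_combination h1
    by_cases h : e ⬝ᵥ z i = e ⬝ᵥ z j
    · rw [h, sub_self, eq_comm, mul_eq_zero, mul_eq_zero, sub_eq_zero] at h2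
      have h3 : (j : ℝ) = i := by
        rcases h2 with h2 | h2 | h2
        exacts [absurd h2 ht0.ne', absurd h2 hε.ne', h2]
      exact Fin.ext (by exact_mod_cast h3.symm)
    · have h3 := hzz i j h
      rw [h2] at h3
      refine absurd (hbound _ ?_) h3.not_gt
      have := hj i
      have := hj j
      have : (0 : ℝ) ≤ i := Nat.cast_nonneg _
      have : (0 : ℝ) ≤ j := Nat.cast_nonneg _
      rw [abs_le]
      constructor <;> linarith
  · have h1 := congrArg (e ⬝ᵥ ·) hij
    simp only [dotProduct_raised _ _ he hef] at h1
    have h2 : e ⬝ᵥ o i - e ⬝ᵥ z j = t * (δ / (n + 2) * ((j : ℝ) + 1)) := by linear_combination h1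
    have hj0 : (0 : ℝ) < j + 1 := by positivity
    by_cases h : e ⬝ᵥ o i = e ⬝ᵥ z j
    · rw [h, sub_self] at h2
      have : 0 < t * (δ / (n + 2) * ((j : ℝ) + 1)) := by positivity
      linarith
    · have h3 := hoz i j h
      rw [h2] at h3
      refine absurd (hbound _ ?_) h3.not_gt
      rw [abs_of_pos hj0]
      linarith [hj j]

lemma injective_append_of_dotProduct (ho : Function.Injective o) (hor : ∀ i, f ⬝ᵥ o i < r)
    (hz : ∀ j, f ⬝ᵥ z j = r + j) (hz' : ∀ j, f ⬝ᵥ z' j = r + j) (t : ℝ) :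
    Function.Injective (Fin.append o fun j => z j + t • (z' j - z j)) := by
  have h : ∀ j, f ⬝ᵥ (z j + t • (z' j - z j)) = r + j := fun j => by
    simp only [dotProduct_add, dotProduct_smul, dotProduct_sub, hz, hz', sub_self, smul_zero,
      add_zero]
  refine Fin.append_injective_iff.2 ⟨ho, fun i j hij => ?_, fun i j hij => ?_⟩
  · have h1 := congrArg (f ⬝ᵥ ·) hij
    simp only [h, add_right_inj, Nat.cast_inj] at h1
    exact Fin.ext h1
  · have h1 := congrArg (f ⬝ᵥ ·) hij
    simp only [h] at h1
    have : (0 : ℝ) ≤ j := Nat.cast_nonneg _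
    linarith [hor i]

variable {S : Type*} [TopologicalSpace S]

/-- The family of configurations obtained by appending the points `z` to the points `o`. -/
def configMap (o : S → Fin m → Fin k → ℝ) (z : S → Fin n → Fin k → ℝ) (ho : Continuous o)
    (hz : Continuous z) (h : ∀ s, Function.Injective (Fin.append (o s) (z s))) :
    C(S, confSet k (m + n)) where
  toFun s := ⟨Fin.append (o s) (z s), h s⟩
  continuous_toFun := (continuous_append ho hz).subtype_mk _

lemma homotopicWith_configMap {o : S → Fin m → Fin k → ℝ} {z z' : S → Fin n → Fin k → ℝ}
    {ho : Continuous o} {hz : Continuous z} {hz' : Continuous z'}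
    {h : ∀ s, Function.Injective (Fin.append (o s) (z s))}
    {h' : ∀ s, Function.Injective (Fin.append (o s) (z' s))}
    (H : ∀ s, ∀ t ∈ Icc (0 : ℝ) 1,
      Function.Injective (Fin.append (o s) fun j => z s j + t • (z' s j - z s j))) :
    (configMap o z ho hz h).HomotopicWith (configMap o z' ho hz' h')
      fun g => ∀ s i, (g s).1 (Fin.castAdd n i) = o s i := by
  refine ⟨⟨⟨⟨fun q => ⟨Fin.append (o q.2) fun j => z q.2 j + (q.1 : ℝ) • (z' q.2 j - z q.2 j),
    H q.2 q.1 q.1.2⟩, ?_⟩, fun s => ?_, fun s => ?_⟩, fun t s i => ?_⟩⟩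
  · refine (continuous_append (by fun_prop) ?_).subtype_mk _
    refine continuous_pi fun j => ?_
    have h1 : Continuous fun s => z s j := by fun_prop
    have h2 : Continuous fun s => z' s j := by fun_prop
    fun_prop
  · apply Subtype.ext
    simp [configMap]
  · apply Subtype.ext
    simp [configMap]
  · simp

/-- The strata have continuous motion planners. -/
theorem dParamSecSet_stratum [NeZero m] (dB : DStruct (confSet k m))
    {e f : (FibreIdx m n → Fin k → ℝ) → Fin k → ℝ} (he : Continuous e) (hf : Continuous f)
    (he0 : ∀ x, leftPts x ∈ confSet k (m + n) → rightPts x ∈ confSet k (m + n) → e x ≠ 0)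
    (hf0 : ∀ x, leftPts x ∈ confSet k (m + n) → rightPts x ∈ confSet k (m + n) → f x ≠ 0)
    (hef : ∀ x, e x ⬝ᵥ f x = 0) (c : ℕ) :
    DParamSecSet (assocDStruct dB (FNmap k m n)) (FNmap k m n) (stratum e c) := by
  have : Nonempty (FibreIdx m n) := ⟨Sum.inl 0⟩
  let X : stratum e c → FibreIdx m n → Fin k → ℝ := fun s => fibrePts s.1
  have hX : Continuous X := continuous_fibrePts.comp continuous_subtype_val
  have hl : ∀ s, leftPts (X s) ∈ confSet k (m + n) := fun s => by
    rw [leftPts_fibrePts]; exact s.1.1.2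
  have hr : ∀ s, rightPts (X s) ∈ confSet k (m + n) := fun s => by
    rw [rightPts_fibrePts s.2.1]; exact s.1.2.2
  have he0 : ∀ s, e (X s) ≠ 0 := fun s => he0 _ (hl s) (hr s)
  have hf0 : ∀ s, f (X s) ≠ 0 := fun s => hf0 _ (hl s) (hr s)
  have heX : Continuous fun s => e (X s) := he.comp hX
  have hfX : Continuous fun s => f (X s) := hf.comp hX
  have hee : ∀ s, e (X s) ⬝ᵥ e (X s) ≠ 0 := fun s => dotProduct_self_eq_zero.not.2 (he0 s)
  have hff : ∀ s, f (X s) ⬝ᵥ f (X s) ≠ 0 := fun s => dotProduct_self_eq_zero.not.2 (hf0 s)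
  let δ : stratum e c → ℝ := fun s => levelGap (heights e (X s))
  have hδ : Continuous δ := continuous_levelGap ((continuous_heights he).comp hX) fun s => s.2.2
  let o : stratum e c → Fin m → Fin k → ℝ := fun s i => X s (Sum.inl i)
  have ho : Continuous o := by fun_prop
  let r : stratum e c → ℝ := fun s => 1 + ∑ i, |f (X s) ⬝ᵥ o s i|
  have hr' : Continuous r := by
    refine continuous_const.add (continuous_finsetSum _ fun i _ => ?_)
    exact (hfX.dotProduct ((continuous_apply i).comp ho)).abs
  have hor : ∀ s i, f (X s) ⬝ᵥ o s i < r s := fun s i => by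
    have h1 := Finset.single_le_sum (f := fun i => |f (X s) ⬝ᵥ o s i|)
      (fun _ _ => abs_nonneg _) (Finset.mem_univ i)
    have h2 := le_abs_self (f (X s) ⬝ᵥ o s i)
    simp only [r]
    linarith
  have hraised : ∀ z : stratum e c → Fin n → Fin k → ℝ, Continuous z →
      Continuous fun s => raised (e (X s)) (f (X s)) (δ s / (n + 2)) (r s) (z s) := by
    intro z hz
    refine continuous_pi fun j => ?_
    have hzj : Continuous fun s => z s j := by fun_prop
    unfold raised
    refine hzj.add (Continuous.add (Continuous.smul (Continuous.div ?_ (heX.dotProduct heX) hee) heX)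
      (Continuous.smul (Continuous.div ?_ (hfX.dotProduct hfX) hff) hfX))
    · fun_prop
    · exact (hr'.add continuous_const).sub (hfX.dotProduct hzj)
  have hstage : ∀ (ι : Fin n → FibreIdx m n)
      (_ : ∀ s, Function.Injective (Fin.append (o s) fun j => X s (ι j))) (s : stratum e c),
      ∀ t ∈ Icc (0 : ℝ) 1, Function.Injective (Fin.append (o s) fun j => X s (ι j) +
        t • (raised (e (X s)) (f (X s)) (δ s / (n + 2)) (r s) (fun j => X s (ι j)) j
          - X s (ι j))) := fun ι hι s t ht =>
    injective_append_raised (he0 s) (hef _) (levelGap_pos _)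
      (fun i j h => levelGap_le (h := heights e (X s)) h)
      (fun i j h => levelGap_le (h := heights e (X s)) h) (hι s) ht
  let ι₁ : Fin n → FibreIdx m n := fun j => Sum.inr (Sum.inl j)
  let ι₂ : Fin n → FibreIdx m n := fun j => Sum.inr (Sum.inr j)
  have h₁ := hstage ι₁ hl
  have h₂ := hstage ι₂ hr
  have hc : ∀ ι : Fin n → FibreIdx m n, Continuous fun s j => X s (ι j) := fun ι => by fun_prop
  have hend : ∀ ι : Fin n → FibreIdx m n, (∀ s, ∀ t ∈ Icc (0 : ℝ) 1,
      Function.Injective (Fin.append (o s) fun j => X s (ι j) +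
        t • (raised (e (X s)) (f (X s)) (δ s / (n + 2)) (r s) (fun j => X s (ι j)) j
          - X s (ι j)))) → ∀ s, Function.Injective (Fin.append (o s)
        (raised (e (X s)) (f (X s)) (δ s / (n + 2)) (r s) fun j => X s (ι j))) := fun ι H s => by
    simpa using H s 1 ⟨zero_le_one, le_rfl⟩
  have H₁ := homotopicWith_configMap (ho := ho) (hz := hc ι₁) (hz' := hraised _ (hc ι₁)) (h := hl)
    (h' := hend ι₁ h₁) h₁
  have H₂ := homotopicWith_configMap (ho := ho) (hz := hc ι₂) (hz' := hraised _ (hc ι₂)) (h := hr)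
    (h' := hend ι₂ h₂) h₂
  have H₃ := homotopicWith_configMap (ho := ho) (hz := hraised _ (hc ι₁))
    (hz' := hraised _ (hc ι₂)) (h := hend ι₁ h₁) (h' := hend ι₂ h₂) fun s t _ =>
      injective_append_of_dotProduct (Fin.append_injective_iff.1 (hl s)).1 (hor s)
        (dotProduct_raised' _ _ (hf0 s) (hef _)) (dotProduct_raised' _ _ (hf0 s) (hef _)) t
  obtain ⟨F⟩ := (H₁.trans H₃).trans H₂.symm
  have hFc : Continuous fun q : stratum e c × I => F (q.2, q.1) := F.continuous.comp continuous_swap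
  refine ⟨(ContinuousMap.curry ⟨_, hFc⟩ : C(stratum e c, C(I, confSet k (m + n)))),
    ContinuousMap.continuous _, fun s => ⟨?_, ?_, ?_⟩⟩
  · have hb : ∀ t, FNmap k m n (F (t, s)) = FNmap k m n s.1.1 := fun t => by
      apply Subtype.ext
      funext i
      exact F.prop t s i
    refine ⟨?_, FNmap k m n s.1.1, hb⟩
    have hconst : (FNmap k m n).comp
        ((ContinuousMap.curry ⟨_, hFc⟩ : C(stratum e c, C(I, confSet k (m + n)))) s) =
        ContinuousMap.const I (FNmap k m n s.1.1) := ContinuousMap.ext hb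
    change (FNmap k m n).comp _ ∈ dB.paths
    rw [hconst]
    exact dB.const_mem _
  · refine (F.map_zero_left s).trans (Subtype.ext ?_)
    exact leftPts_fibrePts s.1
  · refine (F.map_one_left s).trans (Subtype.ext ?_)
    exact rightPts_fibrePts s.2.1

end Planner

/-! ### Upper bounds for the directed parametrized topological complexity -/

section UpperBound

variable {k m n : ℕ}

lemma map_eq_of_mem_GammaEB {E B : Type*} [TopologicalSpace E] [TopologicalSpace B]
    {dE : DStruct E} {p : C(E, B)} {w : E × E} (h : w ∈ GammaEB dE p) : p w.1 = p w.2 := by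
  obtain ⟨γ, ⟨-, b, hb⟩, h0, h1⟩ := h
  rw [← h0, ← h1, hb, hb]

lemma DParamSecSet.mem_GammaEB {E B : Type*} [TopologicalSpace E] [TopologicalSpace B]
    {dE : DStruct E} {p : C(E, B)} {U : Set (E × E)} (h : DParamSecSet dE p U) {w : E × E}
    (hw : w ∈ U) : w ∈ GammaEB dE p := by
  obtain ⟨s, -, hs⟩ := h
  exact ⟨s ⟨w, hw⟩, (hs ⟨w, hw⟩).1, (hs ⟨w, hw⟩).2⟩

/-- Any two configurations in the same fibre are joined by a path in this fibre. -/
lemma mem_GammaEB_FNmap [NeZero m] (dB : DStruct (confSet (k + 2) m))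
    {w : confSet (k + 2) (m + n) × confSet (k + 2) (m + n)}
    (hw : FNmap (k + 2) m n w.1 = FNmap (k + 2) m n w.2) :
    w ∈ GammaEB (assocDStruct dB (FNmap (k + 2) m n)) (FNmap (k + 2) m n) :=
  (dParamSecSet_stratum dB (e := fun _ => Pi.single 0 1) (f := fun _ => Pi.single 1 1)
    continuous_const continuous_const (fun _ _ _ => by simp) (fun _ _ _ => by simp)
    (fun _ => by simp) _).mem_GammaEB ⟨hw, rfl⟩

lemma vTCp_le_of_levelCount [NeZero m] (dB : DStruct (confSet k m))
    {e f : (FibreIdx m n → Fin k → ℝ) → Fin k → ℝ} (he : Continuous e) (hf : Continuous f)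
    (he0 : ∀ x, leftPts x ∈ confSet k (m + n) → rightPts x ∈ confSet k (m + n) → e x ≠ 0)
    (hf0 : ∀ x, leftPts x ∈ confSet k (m + n) → rightPts x ∈ confSet k (m + n) → f x ≠ 0)
    (hef : ∀ x, e x ⬝ᵥ f x = 0)
    (heμ : ∀ x (l : FibreIdx m n → ℝ), ∃ μ : ℝ, e (fun a => x a + l a • e x) = μ • e x)
    {c₀ C : ℕ} (hc : ∀ x, leftPts x ∈ confSet k (m + n) → rightPts x ∈ confSet k (m + n) →
      c₀ ≤ levelCount (heights e x))
    (hC : 2 * n + m < c₀ + C) :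
    vTCp (assocDStruct dB (FNmap k m n)) (FNmap k m n) ≤ C := by
  refine sInf_le ⟨C, rfl, fun i => stratum e (c₀ + i), fun i =>
    ⟨isENR_stratum he he0 heμ _, dParamSecSet_stratum dB he hf he0 hf0 hef _⟩, fun w hw => ?_⟩
  have hw := map_eq_of_mem_GammaEB hw
  have h1 := hc (fibrePts w) (by rw [leftPts_fibrePts]; exact w.1.2)
    (by rw [rightPts_fibrePts hw]; exact w.2.2)
  have h2 := levelCount_le (heights e (fibrePts w))
  simp only [Fintype.card_sum, Fintype.card_fin] at h2
  refine mem_iUnion.2 ⟨⟨levelCount (heights e (fibrePts w)) - c₀, by omega⟩, hw, ?_⟩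
  simp only
  omega

theorem vTCp_FNmap_le [NeZero m] (dB : DStruct (confSet (k + 2) m)) :
    vTCp (assocDStruct dB (FNmap (k + 2) m n)) (FNmap (k + 2) m n) ≤ (2 * n + m : ℕ) := by
  have : Nonempty (FibreIdx m n) := ⟨Sum.inl 0⟩
  exact vTCp_le_of_levelCount dB (e := fun _ => Pi.single 0 1) (f := fun _ => Pi.single 1 1)
    (c₀ := 1) continuous_const continuous_const (fun _ _ _ => by simp) (fun _ _ _ => by simp)
    (fun _ => by simp) (fun _ _ => ⟨1, by simp⟩) (fun _ _ _ => levelCount_pos _) (by omega)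

/-- A quarter turn of a Euclidean space of even dimension. -/
def quarterTurn (v : Fin k → ℝ) (i : Fin k) : ℝ := if 2 * (i : ℕ) < k then v i.rev else -v i.rev

lemma quarterTurn_ne_zero {v : Fin k → ℝ} (hv : v ≠ 0) : quarterTurn v ≠ 0 := by
  contrapose! hv
  funext i
  have := congrFun hv i.rev
  simp only [quarterTurn, Fin.rev_rev] at this
  split_ifs at this
  · exact this
  · exact neg_eq_zero.1 this

lemma dotProduct_quarterTurn (hk : Even k) (v : Fin k → ℝ) : v ⬝ᵥ quarterTurn v = 0 := by
  refine self_eq_neg.1 ?_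
  unfold dotProduct
  rw [← Finset.sum_neg_distrib]
  refine (Equiv.sum_comp Fin.revPerm _).symm.trans (Finset.sum_congr rfl fun i _ => ?_)
  obtain ⟨j, rfl⟩ := hk
  have hi := i.2
  simp only [quarterTurn, Fin.revPerm_apply, Fin.rev_rev, Fin.val_rev]
  split_ifs <;> first | omega | ring

lemma continuous_quarterTurn : Continuous (quarterTurn : (Fin k → ℝ) → Fin k → ℝ) := by
  refine continuous_pi fun i => ?_
  unfold quarterTurn
  split_ifs <;> fun_prop

theorem vTCp_FNmap_le_of_even (hk : Even k) (dB : DStruct (confSet k (m + 2))) :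
    vTCp (assocDStruct dB (FNmap k (m + 2) n)) (FNmap k (m + 2) n) ≤ (2 * n + m + 1 : ℕ) := by
  have he0 : ∀ x : FibreIdx (m + 2) n → Fin k → ℝ, leftPts x ∈ confSet k (m + 2 + n) →
      rightPts x ∈ confSet k (m + 2 + n) → x (Sum.inl 1) - x (Sum.inl 0) ≠ 0 := fun x hl _ h => by
    have h01 : Fin.castAdd n (1 : Fin (m + 2)) = Fin.castAdd n 0 := hl (by
      simpa only [leftPts, Fin.append_left] using sub_eq_zero.1 h)
    simp [Fin.ext_iff] at h01
  refine vTCp_le_of_levelCount dB (e := fun x => x (Sum.inl 1) - x (Sum.inl 0))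
    (f := fun x => quarterTurn (x (Sum.inl 1) - x (Sum.inl 0)))
    (c₀ := 2) (by fun_prop) (continuous_quarterTurn.comp (by fun_prop)) he0
    (fun x hl hr => quarterTurn_ne_zero (he0 x hl hr)) (fun x => dotProduct_quarterTurn hk _)
    (fun x l => ⟨1 + l (Sum.inl 1) - l (Sum.inl 0), ?_⟩)
    (fun x hl hr => one_lt_levelCount (a := Sum.inl 1) (b := Sum.inl 0) fun h => he0 x hl hr ?_)
    (by omega)
  · simp only
    module
  · rw [← dotProduct_self_eq_zero, dotProduct_sub, sub_eq_zero]
    exact h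

end UpperBound

/-! ### Lower bounds for the directed parametrized topological complexity -/

section LowerBound

variable {k m n : ℕ}

lemma DParamSecSet.homotopic {E B T Y : Type*} [TopologicalSpace E] [TopologicalSpace B]
    [TopologicalSpace T] [TopologicalSpace Y] {dE : DStruct E} {p : C(E, B)} {U : Set (E × E)}
    (h : DParamSecSet dE p U) (φ : C(T, E × E)) (F : C(E, Y)) :
    ((F.comp (ContinuousMap.fst.comp φ)).restrict (φ ⁻¹' U)).Homotopic
      ((F.comp (ContinuousMap.snd.comp φ)).restrict (φ ⁻¹' U)) := by
  obtain ⟨s, hs, h⟩ := h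
  let G : C(φ ⁻¹' U, C(I, E)) :=
    ⟨fun y => s ⟨φ y, y.2⟩, hs.comp ((φ.continuous.comp continuous_subtype_val).subtype_mk _)⟩
  refine ⟨⟨⟨fun q => F (G q.2 q.1), F.continuous.comp
    (G.uncurry.continuous.comp continuous_swap)⟩, fun y => ?_, fun y => ?_⟩⟩
  · exact congrArg F (h ⟨φ y, y.2⟩).2.1
  · exact congrArg F (h ⟨φ y, y.2⟩).2.2

lemma dParamSecSet_empty {E B : Type*} [TopologicalSpace E] [TopologicalSpace B]
    (dE : DStruct E) (p : C(E, B)) : DParamSecSet dE p ∅ :=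
  ⟨fun u => u.2.elim, continuous_of_const fun u => u.2.elim, fun u => u.2.elim⟩

/-- The difference of two points of a configuration. -/
def pointDiff {a b : Fin n} (hab : a ≠ b) : C(confSet k n, {v : Fin k → ℝ // v ≠ 0}) where
  toFun z := ⟨z.1 a - z.1 b, sub_ne_zero.2 fun h => hab (z.2 h)⟩
  continuous_toFun := by
    apply Continuous.subtype_mk
    exact ((continuous_apply a).comp continuous_subtype_val).sub
      ((continuous_apply b).comp continuous_subtype_val)

lemma homotopic_of_norm_sub_lt {V T : Type*} [NormedAddCommGroup V] [NormedSpace ℝ V]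
    [TopologicalSpace T] {f g : C(T, {v : V // v ≠ 0})} {c : ℝ}
    (h : ∀ y, ‖(f y : V) - c • (g y : V)‖ < c * ‖(g y : V)‖) : f.Homotopic g := by
  refine ⟨⟨⟨fun q => ⟨(1 - (q.1 : ℝ)) • (f q.2 : V) + (q.1 : ℝ) • (g q.2 : V), fun h0 => ?_⟩,
    by fun_prop⟩, fun y => by simp, fun y => by simp⟩⟩
  obtain ⟨⟨t, ht0, ht1⟩, y⟩ := q
  dsimp only at h0
  rcases ht1.eq_or_lt with rfl | ht1
  · exact (g y).2 (by simpa using h0)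
  have h1 := h y
  have hfg : (1 - t) • ((f y : V) - c • (g y : V)) = -((t + (1 - t) * c) • (g y : V)) := by
    rw [eq_neg_iff_add_eq_zero]
    refine Eq.trans ?_ h0
    module
  have hc : 0 < c := pos_of_mul_pos_left ((norm_nonneg _).trans_lt h1) (norm_nonneg _)
  have ht : 0 < 1 - t := by linarith
  have h2 := congrArg norm hfg
  rw [norm_neg, norm_smul, norm_smul, Real.norm_of_nonneg ht.le,
    Real.norm_of_nonneg (by positivity)] at h2
  nlinarith [mul_lt_mul_of_pos_left h1 ht, mul_nonneg ht0 (norm_nonneg (g y : V))]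

/-- Radii of the points of a star configuration. -/
noncomputable def starRadius (a : ℕ) : ℝ := if a < 2 then 0 else 1 / (a + 4)

/-- Positions of the centres of the points of a star configuration along its axis. -/
def starCenter (m : ℕ) (s : ℝ) (a : ℕ) : ℝ := if a = 0 then 0 else if a < m then 1 else s

lemma starRadius_nonneg (a : ℕ) : 0 ≤ starRadius a := by
  unfold starRadius; split_ifs <;> positivity

lemma starRadius_pos {a : ℕ} (ha : 2 ≤ a) : 0 < starRadius a := by
  rw [starRadius, if_neg (by omega)]; positivity

lemma starRadius_lt (a : ℕ) : starRadius a < 1 / 2 := by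
  unfold starRadius
  split_ifs
  · norm_num
  · exact one_div_lt_one_div_of_lt (by norm_num) (by have : (0 : ℝ) ≤ a := a.cast_nonneg; linarith)

lemma starRadius_lt_starRadius {a b : ℕ} (ha : 2 ≤ a) (hab : a < b) :
    starRadius b < starRadius a := by
  rw [starRadius, starRadius, if_neg (by omega), if_neg (by omega)]
  exact one_div_lt_one_div_of_lt (by positivity) (by gcongr)

variable {V : Type*} [NormedAddCommGroup V] [NormedSpace ℝ V]

/-- A star configuration: small mutually disjoint spheres around the endpoints of the axis `q`,
each carrying one point. -/
noncomputable def starPts (m : ℕ) (s : ℝ) (q : V) {M : ℕ} (v : Fin M → V) (a : Fin M) : V :=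
  starCenter m s a • q + starRadius a • v a

lemma injective_starPts (hm : 2 ≤ m) {s : ℝ} (hs : s = 0 ∨ s = 1) {q : V} (hq : ‖q‖ = 1) {M : ℕ}
    {v : Fin M → V} (hv : ∀ a, ‖v a‖ = 1) : Function.Injective (starPts m s q v) := by
  intro a b h
  have hc : ∀ a, starCenter m s a = 0 ∨ starCenter m s a = 1 := fun a => by
    unfold starCenter
    split_ifs <;> simp [hs]
  have hnorm : ∀ a : Fin M, ‖starRadius a • v a‖ = starRadius a := fun a => by
    rw [norm_smul, hv, mul_one, Real.norm_of_nonneg (starRadius_nonneg _)]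
  have h1 : (starCenter m s a - starCenter m s b) • q =
      starRadius b • v b - starRadius a • v a := by
    unfold starPts at h
    rw [sub_smul, sub_eq_sub_iff_add_eq_add, add_comm (starRadius b • v b), ← h]
  have h2 := norm_sub_le (starRadius b • v b) (starRadius a • v a)
  rw [← h1, norm_smul, hq, hnorm, hnorm, mul_one, Real.norm_eq_abs] at h2
  have h3 := starRadius_lt a
  have h4 := starRadius_lt b
  have hcc : starCenter m s a = starCenter m s b := by
    rcases hc a with ha | ha <;> rcases hc b with hb | hb <;> rw [ha, hb] at h2 ⊢ <;>
      norm_num at h2 <;> linarith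
  rw [hcc, sub_self, zero_smul, eq_comm, sub_eq_zero] at h1
  have hr := congrArg norm h1
  rw [hnorm, hnorm] at hr
  by_contra hab
  have hab : (a : ℕ) ≠ b := fun h => hab (Fin.ext h)
  by_cases ha : (a : ℕ) < 2
  · by_cases hb : (b : ℕ) < 2
    · unfold starCenter at hcc
      split_ifs at hcc <;> first | omega | norm_num at hcc
    · have := starRadius_pos (not_lt.1 hb)
      rw [hr] at this
      simp [starRadius, ha] at this
  · rcases hab.lt_or_gt with hlt | hlt
    · exact (starRadius_lt_starRadius (not_lt.1 ha) hlt).ne hr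
    · by_cases hb : (b : ℕ) < 2
      · have := starRadius_pos (not_lt.1 ha)
        rw [← hr] at this
        simp [starRadius, hb] at this
      · exact (starRadius_lt_starRadius (not_lt.1 hb) hlt).ne hr.symm

lemma starPts_zero (s : ℝ) (q : V) {M : ℕ} (v : Fin M → V) {a : Fin M} (ha : (a : ℕ) = 0) :
    starPts m s q v a = 0 := by
  simp [starPts, starCenter, starRadius, ha]

lemma starPts_one (hm : 1 < m) (s : ℝ) (q : V) {M : ℕ} (v : Fin M → V) {a : Fin M}
    (ha : (a : ℕ) = 1) : starPts m s q v a = q := by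
  simp [starPts, starCenter, starRadius, ha, hm]

lemma starPts_of_lt (s : ℝ) (q : V) {M : ℕ} (v : Fin M → V) {a : Fin M} (ha0 : (a : ℕ) ≠ 0)
    (ha : (a : ℕ) < m) : starPts m s q v a = q + starRadius a • v a := by
  simp [starPts, starCenter, ha, ha0]

lemma starPts_of_le (s : ℝ) (q : V) {M : ℕ} (v : Fin M → V) {a : Fin M} (ha0 : (a : ℕ) ≠ 0)
    (ha : m ≤ (a : ℕ)) : starPts m s q v a = s • q + starRadius a • v a := by
  simp [starPts, starCenter, ha.not_gt, ha0]

/-- A family of pairs of star configurations in the same fibre, along which motion planning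
deforms each of the given maps to spheres to the axis. -/
theorem exists_starMap [NeZero n] {T : Type*} [TopologicalSpace T]
    (q : C(T, {v : Fin k → ℝ // v ≠ 0})) (hq : ∀ y, ‖(q y : Fin k → ℝ)‖ = 1)
    (u : Fin n ⊕ Fin n ⊕ Fin m → C(T, {v : Fin k → ℝ // v ≠ 0}))
    (hu : ∀ j y, ‖(u j y : Fin k → ℝ)‖ = 1) :
    ∃ φ : C(T, confSet k (m + 2 + n) × confSet k (m + 2 + n)),
      (∀ y, FNmap k (m + 2) n (φ y).1 = FNmap k (m + 2) n (φ y).2) ∧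
      ∀ dE U, DParamSecSet dE (FNmap k (m + 2) n) U → ∀ j,
        ((u j).restrict (φ ⁻¹' U)).Homotopic (q.restrict (φ ⁻¹' U)) := by
  let vo : T → Fin (m + 2) → Fin k → ℝ := fun y =>
    Fin.cons (q y) (Fin.cons (q y) fun l => (u (Sum.inr (Sum.inr l)) y : Fin k → ℝ))
  let vl : T → Fin (m + 2 + n) → Fin k → ℝ := fun y =>
    Fin.append (vo y) fun i => u (Sum.inl i) y
  let vr : T → Fin (m + 2 + n) → Fin k → ℝ := fun y =>
    Fin.append (vo y) fun i => -u (Sum.inr (Sum.inl i)) y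
  have hvo : Continuous vo := by fun_prop
  have hvo1 : ∀ y i, ‖vo y i‖ = 1 := fun y i => by
    refine Fin.cases (hq y) (fun i => Fin.cases (hq y) (fun i => ?_) i) i
    exact hu _ y
  have hvl : Continuous vl := continuous_append hvo (by fun_prop)
  have hvr : Continuous vr := continuous_append hvo (by fun_prop)
  have hvl1 : ∀ y a, ‖vl y a‖ = 1 := fun y a => by
    refine Fin.addCases (fun i => ?_) (fun i => ?_) a <;> simp [vl, hvo1, hu]
  have hvr1 : ∀ y a, ‖vr y a‖ = 1 := fun y a => by
    refine Fin.addCases (fun i => ?_) (fun i => ?_) a <;> simp [vr, hvo1, hu]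
  let φ : C(T, confSet k (m + 2 + n) × confSet k (m + 2 + n)) :=
    ⟨fun y => (⟨starPts (m + 2) 0 (q y : Fin k → ℝ) (vl y),
        injective_starPts (by omega) (by simp) (hq y) (hvl1 y)⟩,
      ⟨starPts (m + 2) 1 (q y : Fin k → ℝ) (vr y),
        injective_starPts (by omega) (by simp) (hq y) (hvr1 y)⟩), by
      unfold starPts
      fun_prop⟩
  refine ⟨φ, fun y => Subtype.ext (funext fun i => ?_), fun dE U hU j => ?_⟩
  · simp [φ, FNmap, starPts, vl, vr, starCenter]
  have key : ∀ {a b : Fin (m + 2 + n)} (hab : a ≠ b) {f g : C(T, {v : Fin k → ℝ // v ≠ 0})}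
      (_ : ((pointDiff hab).comp (ContinuousMap.fst.comp φ)).Homotopic f)
      (_ : ((pointDiff hab).comp (ContinuousMap.snd.comp φ)).Homotopic g),
      (f.restrict (φ ⁻¹' U)).Homotopic (g.restrict (φ ⁻¹' U)) := fun hab f g hf hg =>
    (((hf.symm.comp (.refl ⟨Subtype.val, continuous_subtype_val⟩)).trans
      (hU.homotopic φ (pointDiff hab))).trans
      (hg.comp (.refl ⟨Subtype.val, continuous_subtype_val⟩)))
  have hρ : ∀ a j y, ‖starRadius a • (u j y : Fin k → ℝ)‖ = starRadius a := fun a j y => by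
    rw [norm_smul, hu, mul_one, Real.norm_of_nonneg (starRadius_nonneg _)]
  have hl0 : ∀ y, (φ y).1.1 (Fin.castAdd n 0) = 0 := fun y => starPts_zero _ _ _ (by simp)
  have hr0 : ∀ y, (φ y).2.1 (Fin.castAdd n 0) = 0 := fun y => starPts_zero _ _ _ (by simp)
  have hl1 : ∀ y, (φ y).1.1 (Fin.castAdd n 1) = q y := fun y =>
    starPts_one (by omega) _ _ _ (by simp)
  have hr1 : ∀ y, (φ y).2.1 (Fin.castAdd n 1) = q y := fun y =>
    starPts_one (by omega) _ _ _ (by simp)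
  have hlo : ∀ l y, (φ y).1.1 (Fin.castAdd n (Fin.succ (Fin.succ l))) =
      q y + starRadius (l + 2) • (u (Sum.inr (Sum.inr l)) y : Fin k → ℝ) := fun l y =>
    (starPts_of_lt _ _ _ (by simp) (by simp)).trans (by simp [vl, vo])
  have hro : ∀ l y, (φ y).2.1 (Fin.castAdd n (Fin.succ (Fin.succ l))) =
      q y + starRadius (l + 2) • (u (Sum.inr (Sum.inr l)) y : Fin k → ℝ) := fun l y =>
    (starPts_of_lt _ _ _ (by simp) (by simp)).trans (by simp [vr, vo])
  have hlz : ∀ i y, (φ y).1.1 (Fin.natAdd (m + 2) i) =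
      starRadius (m + 2 + i) • (u (Sum.inl i) y : Fin k → ℝ) := fun i y =>
    (starPts_of_le _ _ _ (by simp) (by simp)).trans (by simp [vl])
  have hrz : ∀ i y, (φ y).2.1 (Fin.natAdd (m + 2) i) =
      q y - starRadius (m + 2 + i) • (u (Sum.inr (Sum.inl i)) y : Fin k → ℝ) := fun i y =>
    (starPts_of_le _ _ _ (by simp) (by simp)).trans (by simp [vr, sub_eq_add_neg])
  have hne : ∀ (a : Fin (m + 2)) (i : Fin n), Fin.castAdd n a ≠ Fin.natAdd (m + 2) i :=
    fun a i h => by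
      have := congrArg Fin.val h
      have := a.2
      simp only [Fin.val_castAdd, Fin.val_natAdd] at *
      omega
  rcases j with i | i | l
  · refine key (a := Fin.natAdd (m + 2) i) (b := Fin.castAdd n 0) (hne _ _).symm
      (homotopic_of_norm_sub_lt (c := starRadius (m + 2 + i)) fun y => ?_)
      (homotopic_of_norm_sub_lt (c := 1) fun y => ?_)
    · change ‖(φ y).1.1 _ - (φ y).1.1 _ - _‖ < _
      rw [hlz, hl0, hu, sub_zero, sub_self, norm_zero, mul_one]
      exact starRadius_pos (by omega)
    · change ‖(φ y).2.1 _ - (φ y).2.1 _ - _‖ < _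
      rw [hrz, hr0, hq, sub_zero, one_smul, sub_sub_cancel_left, norm_neg, hρ]
      linarith [starRadius_lt (m + 2 + i)]
  · refine (key (b := Fin.natAdd (m + 2) i) (a := Fin.castAdd n 1) (hne _ _)
      (homotopic_of_norm_sub_lt (c := 1) fun y => ?_)
      (homotopic_of_norm_sub_lt (c := starRadius (m + 2 + i)) fun y => ?_)).symm
    · change ‖(φ y).1.1 _ - (φ y).1.1 _ - _‖ < _
      rw [hlz, hl1, hq, one_smul, sub_sub_cancel_left, norm_neg, hρ]
      linarith [starRadius_lt (m + 2 + i)]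
    · change ‖(φ y).2.1 _ - (φ y).2.1 _ - _‖ < _
      rw [hrz, hr1, hu, sub_sub_cancel, sub_self, norm_zero, mul_one]
      exact starRadius_pos (by omega)
  · refine (key (b := Fin.natAdd (m + 2) 0) (a := Fin.castAdd n l.succ.succ) (hne _ _)
      (homotopic_of_norm_sub_lt (c := 1) fun y => ?_)
      (homotopic_of_norm_sub_lt (c := starRadius (l + 2)) fun y => ?_)).symm
    · change ‖(φ y).1.1 _ - (φ y).1.1 _ - _‖ < _
      rw [hlz, hlo, hq, one_smul, add_sub_right_comm, add_sub_right_comm, sub_sub_cancel_left,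
        neg_add_eq_sub]
      refine (norm_sub_le _ _).trans_lt ?_
      rw [hρ, hρ]
      linarith [starRadius_lt (l + 2), starRadius_lt (m + 2 + (0 : Fin n))]
    · change ‖(φ y).2.1 _ - (φ y).2.1 _ - _‖ < _
      rw [hrz, hro, hu, add_sub_sub_cancel, add_sub_cancel_left, hρ, mul_one]
      exact starRadius_lt_starRadius (by omega) (by omega)

/-- If no `N` sets with motion planners cover the pairs of endpoints, then the complexity
exceeds `N`. -/
lemma le_vTCp_of_forall_not_subset {E B : Type*} [TopologicalSpace E] [TopologicalSpace B] {dE : DStruct E}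
    {p : C(E, B)} {N : ℕ} (h : ∀ U : Fin N → Set (E × E), (∀ i, DParamSecSet dE p (U i)) →
      ¬ GammaEB dE p ⊆ ⋃ i, U i) : ((N + 1 : ℕ) : ℕ∞) ≤ vTCp dE p := by
  refine le_sInf ?_
  rintro _ ⟨M, rfl, U, hU, hcov⟩
  by_contra hlt
  have hM : M ≤ N := by
    rw [not_le, Nat.cast_lt] at hlt
    omega
  refine h (fun i => if h : (i : ℕ) < M then U ⟨i, h⟩ else ∅) (fun i => ?_) fun w hw => ?_
  · split_ifs
    · exact (hU _).2
    · exact dParamSecSet_empty dE p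
  · obtain ⟨i, hi⟩ := mem_iUnion.1 (hcov hw)
    exact mem_iUnion.2 ⟨Fin.castLE hM i, by simpa using hi⟩

theorem le_vTCp_FNmap [NeZero n] (dB : DStruct (confSet (k + 2) (m + 2))) :
    (2 * n + m + 1 : ℕ) ≤ vTCp (assocDStruct dB (FNmap (k + 2) (m + 2) n))
      (FNmap (k + 2) (m + 2) n) := by
  refine le_vTCp_of_forall_not_subset fun U hU hcov => ?_
  let e : Fin n ⊕ Fin n ⊕ Fin m ≃ Fin (2 * n + m) := Fintype.equivFinOfCardEq (by simp; omega)
  let c : {v : Fin (k + 2) → ℝ // v ≠ 0} := ⟨Pi.single 0 1, by simp⟩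
  obtain ⟨φ, hφ, H⟩ := exists_starMap (n := n) (m := m)
    (ContinuousMap.const (Fin (2 * n + m) → SupSphere (k + 2)) c) (fun _ => (Pi.norm_single _).trans norm_one)
    (fun j => sphereProj (e j)) fun j y => by simp [sphereProj]
  refine not_homotopic_const_of_cover (by have := NeZero.pos n; omega)
    (A := fun j => φ ⁻¹' U j) (g := fun _ => ContinuousMap.const _ c) ?_
    (fun _ => ⟨_, fun _ => rfl⟩) fun j => ?_
  · rw [← preimage_iUnion, eq_univ_iff_forall]
    exact fun y => hcov (mem_GammaEB_FNmap dB (hφ y))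
  · simpa using H _ _ (hU j) (e.symm j)

theorem le_vTCp_FNmap_of_odd [NeZero n] (hk : Odd k)
    (dB : DStruct (confSet (k + 2) (m + 2))) :
    (2 * n + m + 2 : ℕ) ≤ vTCp (assocDStruct dB (FNmap (k + 2) (m + 2) n))
      (FNmap (k + 2) (m + 2) n) := by
  refine le_vTCp_of_forall_not_subset (N := 2 * n + m + 1) fun U hU hcov => ?_
  let e : Fin n ⊕ Fin n ⊕ Fin m ≃ Fin (2 * n + m) := Fintype.equivFinOfCardEq (by simp; omega)
  let b : Fin (2 * n + m + 1) := Fin.last _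
  let a : Fin (2 * n + m + 1) := (e (Sum.inl 0)).castSucc
  have hab : a ≠ b := Fin.castSucc_ne_last _
  obtain ⟨φ, hφ, H⟩ := exists_starMap (n := n) (m := m) (k := k + 2) (sphereProj b)
    (fun y => by simp [sphereProj])
    (fun j => sphereProj (e j).castSucc)
    fun j y => by simp [sphereProj]
  refine not_homotopic_swap_of_cover hk.add_one hab (A := fun j => φ ⁻¹' U j)
    (g := fun j => if j = b then sphereProj a else sphereProj b) ?_ (by simp [hab]) (by simp)
    (fun j _ hj => ⟨Subtype.val, fun y => by simp [hj, sphereProj]⟩) fun j => ?_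
  · rw [← preimage_iUnion, eq_univ_iff_forall]
    exact fun y => hcov (mem_GammaEB_FNmap dB (hφ y))
  · refine Fin.lastCases ?_ (fun j => ?_) j
    · simpa [b] using (H _ _ (hU b) (Sum.inl 0)).symm
    · simpa [b] using H _ _ (hU j.castSucc) (e.symm j)

end LowerBound

/-- For `m ≥ 2`, `n ≥ 1`, `k ≥ 2`, the Fadell–Neuwirth fibration
`p : F(ℝ^k, m+n) → F(ℝ^k, m)`, where the base carries the d-structure of paths that are
non-decreasing in each of the `km` real coordinates and the total space carries the
associated d-structure, has directed parametrized topological complexity `2n + m` if `k`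
is odd and `2n + m − 1` if `k` is even. -/
theorem vTCp_fadellNeuwirth (k m n : ℕ) (hk : 2 ≤ k) (hm : 2 ≤ m) (hn : 1 ≤ n) :
    (Odd k → vTCp (assocDStruct (monoDStruct (confSet k m)) (FNmap k m n)) (FNmap k m n)
        = ((2 * n + m : ℕ) : ℕ∞)) ∧
    (Even k → vTCp (assocDStruct (monoDStruct (confSet k m)) (FNmap k m n)) (FNmap k m n)
        = ((2 * n + m - 1 : ℕ) : ℕ∞)) := by
  obtain ⟨k, rfl⟩ := Nat.exists_eq_add_of_le' hk
  obtain ⟨m, rfl⟩ := Nat.exists_eq_add_of_le' hm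
  have : NeZero n := ⟨by omega⟩
  refine ⟨fun h => le_antisymm (vTCp_FNmap_le _) (le_vTCp_FNmap_of_odd ?_ _), fun h => ?_⟩
  · exact (Nat.odd_add.1 h).2 even_two
  · exact le_antisymm (vTCp_FNmap_le_of_even h _) (le_vTCp_FNmap _)
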